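/- arXiv:2305.02431 — 2 statements merged into one kernel-verified Lean document; each statement's English description precedes it below -/
import Mathlib

section
/- (Hodge–Lepage decomposition.) For every 2 ≤ k ≤ n and every differential k-form ω on ℝ^{2n+1} with χ ⌟ ω = 0, there exist a (k−2)-form x with χ ⌟ x = 0 and a k-form ω_ε with χ ⌟ ω_ε = 0 and ⊥ω_ε = 0 such that ω = ω_ε + x ∧ Ω. Moreover, ω_ε is uniquely determined by ω (while x need not be unique). -/
noncomputable section

namespace MA

/-- Points / tangent vectors of ℝ^m. -/
abbrev Vec (m : ℕ) := Fin m → ℝ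

/-- An (unbundled) differential `k`-form on ℝ^m : at each point it eats a
`k`-tuple of tangent vectors and returns a real number. -/
abbrev Form (m k : ℕ) := Vec m → (Fin k → Vec m) → ℝ

/-- `ω` is pointwise an alternating multilinear map, i.e. a genuine exterior form. -/
def IsForm {m k : ℕ} (ω : Form m k) : Prop :=
  ∀ x : Vec m, ∃ a : AlternatingMap ℝ (Vec m) ℝ (Fin k), ∀ v, ω x v = a v

/-- Smoothness of a differential form (smoothness of all coefficients). -/
def SmoothForm {m k : ℕ} (ω : Form m k) : Prop :=
  ∀ v : Fin k → Vec m, ContDiff ℝ (⊤ : ℕ∞) fun x => ω x v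

/-- Multiplication of a form by a scalar function. -/
def fsmul {m k : ℕ} (f : Vec m → ℝ) (ω : Form m k) : Form m k := fun x v => f x * ω x v

/-- Wedge (exterior) product of differential forms. -/
def wedge {m k l : ℕ} (ω : Form m k) (η : Form m l) : Form m (k + l) := fun x v =>
  ((k.factorial * l.factorial : ℕ) : ℝ)⁻¹ *
    ∑ σ : Equiv.Perm (Fin (k + l)),
      ((Equiv.Perm.sign σ : ℤ) : ℝ) *
        (ω x fun i => v (σ (Fin.castAdd l i))) *
        (η x fun j => v (σ (Fin.natAdd k j)))

/-- Interior product (contraction) of a form with a (constant) vector. -/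
def iprod {m : ℕ} (u : Vec m) : ∀ {k : ℕ}, Form m k → Form m (k - 1)
  | 0, _ => 0
  | _ + 1, ω => fun x v => ω x (Fin.cons u v)

/-- Exterior derivative of a differential form (coordinate formula). -/
def exd {m k : ℕ} (ω : Form m k) : Form m (k + 1) := fun x v =>
  ∑ i : Fin (k + 1),
    (-1 : ℝ) ^ (i : ℕ) * fderiv ℝ (fun y => ω y fun j => v (i.succAbove j)) x (v i)

/-- Change the (propositionally equal) degree of a form. -/
def reindex {m k l : ℕ} (h : k = l) (ω : Form m k) : Form m l :=
  fun x v => ω x fun i => v (Fin.cast h i)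

/-- Pullback of a differential form along a map. -/
def pullback {a b k : ℕ} (f : Vec a → Vec b) (ω : Form b k) : Form a k :=
  fun x v => ω (f x) fun i => fderiv ℝ f x (v i)

/-- `i`-th standard basis vector of ℝ^m. -/
def basisVec {m : ℕ} (i : Fin m) : Vec m := Pi.single i 1

/-- The coordinate 1-form `dx^i`. -/
def dx {m : ℕ} (i : Fin m) : Form m 1 := fun _ v => v 0 i

/-- Partial derivative of a function in the `i`-th coordinate direction. -/
def pd {m : ℕ} (i : Fin m) (f : Vec m → ℝ) : Vec m → ℝ := fun x => fderiv ℝ f x (basisVec i)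

/- Jet-space coordinates on J¹ℝⁿ = ℝ^{2n+1} : (q¹,…,qⁿ,u,p₁,…,pₙ). -/

/-- Index of the coordinate `q^μ`. -/
def qIdx {n : ℕ} (μ : Fin n) : Fin (2 * n + 1) := ⟨μ, by have := μ.isLt; omega⟩

/-- Index of the coordinate `u`. -/
def uIdx {n : ℕ} : Fin (2 * n + 1) := ⟨n, by omega⟩

/-- Index of the coordinate `p_μ`. -/
def pIdx {n : ℕ} (μ : Fin n) : Fin (2 * n + 1) := ⟨n + 1 + μ, by have := μ.isLt; omega⟩

/-- The Reeb field `χ = ∂/∂u` (a constant vector field). -/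
def chi {n : ℕ} : Vec (2 * n + 1) := basisVec uIdx

/-- The standard contact form `c = du - Σ p_μ dq^μ` on J¹ℝⁿ. -/
def contact {n : ℕ} : Form (2 * n + 1) 1 := fun x v =>
  v 0 uIdx - ∑ μ : Fin n, x (pIdx μ) * v 0 (qIdx μ)

/-- The symplectic-type 2-form `Ω = dc = Σ dq^μ ∧ dp_μ`. -/
def symp {n : ℕ} : Form (2 * n + 1) 2 := ∑ μ : Fin n, wedge (dx (qIdx μ)) (dx (pIdx μ))

/-- The bottom operator `⊥ = Σ_μ ∂_{p_μ} ⌟ ∂_{q^μ} ⌟ ·` (zero on forms of degree ≤ 1). -/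
def botOp {n k : ℕ} (ω : Form (2 * n + 1) k) : Form (2 * n + 1) (k - 2) :=
  ∑ μ : Fin n, iprod (basisVec (pIdx μ)) (iprod (basisVec (qIdx μ)) ω)

/-- A form is effective if it is killed by `χ ⌟ ·` and by `⊥`. -/
def Effective {n k : ℕ} (ω : Form (2 * n + 1) k) : Prop :=
  iprod (chi (n := n)) ω = 0 ∧ botOp ω = 0

/-- The projection `p(α) = α - c ∧ (χ ⌟ α)` onto forms annihilated by `χ ⌟ ·`. -/
def proj {n : ℕ} : ∀ {k : ℕ}, Form (2 * n + 1) k → Form (2 * n + 1) k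
  | 0, α => α
  | j + 1, α => α - reindex (Nat.add_comm 1 j) (wedge contact (iprod (chi (n := n)) α))

/-- The projected exterior derivative `d_p = p ∘ d`. -/
def dproj {n k : ℕ} (ω : Form (2 * n + 1) k) : Form (2 * n + 1) (k + 1) := proj (exd ω)

/-- Lie derivative along the (constant) Reeb field `χ`. -/
def lieChi {n k : ℕ} (ω : Form (2 * n + 1) k) : Form (2 * n + 1) k := fun x v =>
  fderiv ℝ (fun y => ω y v) x (chi (n := n))

/-- The Euler operator `E = d_p ∘ ⊥ ∘ d_p + L_χ` on n-forms over J¹ℝⁿ. -/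
def euler : ∀ {n : ℕ}, Form (2 * n + 1) n → Form (2 * n + 1) n
  | 0, ω => lieChi ω
  | n + 1, ω =>
    reindex (show n + 1 + 1 - 2 + 1 = n + 1 by omega) (dproj (botOp (dproj ω))) + lieChi ω

/-- The horizontal volume form `β = dq¹ ∧ … ∧ dqⁿ` on J¹ℝⁿ. -/
def qvol {n : ℕ} : Form (2 * n + 1) n := fun _ v =>
  Matrix.det (Matrix.of fun i j : Fin n => v i (qIdx j))

/-- The volume form `β = dq¹ ∧ … ∧ dqⁿ` on the base ℝⁿ. -/
def baseVol {n : ℕ} : Form n n := fun _ v => Matrix.det (Matrix.of fun i j : Fin n => v i j)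

/-- `β_μ = ∂_{q^μ} ⌟ β`. -/
def betaMu {n : ℕ} (μ : Fin n) : Form (2 * n + 1) (n - 1) := iprod (basisVec (qIdx μ)) qvol

/-- The first jet prolongation `j¹φ : ℝⁿ → ℝ^{2n+1}`, `x ↦ (x, φ(x), ∂₁φ(x), …, ∂ₙφ(x))`. -/
def jet {n : ℕ} (φ : Vec n → ℝ) (x : Vec n) : Vec (2 * n + 1) := fun i =>
  if h : (i : ℕ) < n then x ⟨i, h⟩
  else if h2 : (i : ℕ) = n then φ x
  else fderiv ℝ φ x (basisVec ⟨(i : ℕ) - (n + 1), by have := i.isLt; omega⟩)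

/-- Second partial derivative `φ_{μν} = ∂²φ/∂q^μ∂q^ν`. -/
def d2 {n : ℕ} (φ : Vec n → ℝ) (μ ν : Fin n) : Vec n → ℝ := fun x =>
  fderiv ℝ (fun y => fderiv ℝ φ y (basisVec ν)) x (basisVec μ)

/-- A form is multisymplectic if it is closed and pointwise nondegenerate. -/
def Multisymplectic {m k : ℕ} (μ : Form m k) : Prop :=
  exd μ = 0 ∧ ∀ (x v : Vec m), iprod v μ x = 0 → v = 0

/-- Lift a form on J¹ℝⁿ = ℝ^{2n+1} to ℝ^{2n+2} = J¹ℝⁿ × ℝ (extra coordinate `e`)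
along the projection. -/
def liftForm {n k : ℕ} (ω : Form (2 * n + 1) k) : Form (2 * n + 1 + 1) k :=
  pullback (fun y (i : Fin (2 * n + 1)) => y i.castSucc) ω

/-- The 1-form `de` on ℝ^{2n+2}. -/
def deForm {n : ℕ} : Form (2 * n + 1 + 1) 1 := dx (Fin.last (2 * n + 1))

/-- The (n+1)-form `m_ω = de ∧ β + c ∧ ω` on ℝ^{2n+2}. -/
def msf {n : ℕ} (ω : Form (2 * n + 1) n) : Form (2 * n + 1 + 1) (n + 1) :=
  reindex (Nat.add_comm 1 n) (wedge (deForm (n := n)) (liftForm qvol)) +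
    reindex (Nat.add_comm 1 n) (wedge (liftForm (contact (n := n))) (liftForm ω))

open scoped InnerProductSpace

/-- Exterior forms of degree `k` on `ℝ^m`. -/
abbrev Alt (m k : ℕ) := AlternatingMap ℝ (Vec m) ℝ (Fin k)

theorem alt_sum_apply {ι : Type*} {m k : ℕ} (s : Finset ι) (f : ι → Alt m k)
    (v : Fin k → Vec m) : (∑ i ∈ s, f i) v = ∑ i ∈ s, f i v :=
  map_sum (⟨⟨fun a : Alt m k => a v, rfl⟩, fun _ _ => rfl⟩ : Alt m k →+ ℝ) f s

/-- The product `v ↦ a(v₁, …, v_k) b(v_{k+1}, …, v_{k+l})`. -/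
def tensorMul {m k l : ℕ} (a : Alt m k) (b : Alt m l) :
    MultilinearMap ℝ (fun _ : Fin (k + l) => Vec m) ℝ :=
  (LinearMap.mul' ℝ ℝ).compMultilinearMap
    ((MultilinearMap.domCoprod a.toMultilinearMap b.toMultilinearMap).domDomCongr finSumFinEquiv)

theorem tensorMul_apply {m k l : ℕ} (a : Alt m k) (b : Alt m l) (v : Fin (k + l) → Vec m) :
    tensorMul a b v = a (fun i => v (Fin.castAdd l i)) * b (fun i => v (Fin.natAdd k i)) := by
  simp [tensorMul]

/-- Wedge product of exterior forms. -/
def wedgeAlt {m k l : ℕ} (a : Alt m k) (b : Alt m l) : Alt m (k + l) :=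
  ((k.factorial * l.factorial : ℕ) : ℝ)⁻¹ • MultilinearMap.alternatization (tensorMul a b)

theorem wedgeAlt_apply {m k l : ℕ} (a : Alt m k) (b : Alt m l) (v : Fin (k + l) → Vec m) :
    wedgeAlt a b v = ((k.factorial * l.factorial : ℕ) : ℝ)⁻¹ *
      ∑ σ : Equiv.Perm (Fin (k + l)), ((Equiv.Perm.sign σ : ℤ) : ℝ) *
        (a fun i => v (σ (Fin.castAdd l i))) * (b fun j => v (σ (Fin.natAdd k j))) := by
  simp only [wedgeAlt, AlternatingMap.smul_apply, MultilinearMap.alternatization_apply,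
    MultilinearMap.domDomCongr_apply, tensorMul_apply, smul_eq_mul, Units.smul_def,
    zsmul_eq_mul, mul_assoc]

theorem wedge_eq_wedgeAlt {m k l : ℕ} {ω : Form m k} {η : Form m l} {a : Alt m k} {b : Alt m l}
    {x : Vec m} (ha : ∀ v, ω x v = a v) (hb : ∀ v, η x v = b v) (v : Fin (k + l) → Vec m) :
    wedge ω η x v = wedgeAlt a b v := by
  simp only [wedge, wedgeAlt_apply, ha, hb]

/-- Right multiplication by `b` as a linear map. -/
def wedgeRight {m l : ℕ} (k : ℕ) (b : Alt m l) : Alt m k →ₗ[ℝ] Alt m (k + l) where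
  toFun a := wedgeAlt a b
  map_add' a a' := by
    ext v
    simp only [wedgeAlt_apply, AlternatingMap.add_apply, mul_add, add_mul, Finset.sum_add_distrib]
  map_smul' r a := by
    ext v
    simp only [wedgeAlt_apply, AlternatingMap.smul_apply, smul_eq_mul, RingHom.id_apply,
      Finset.mul_sum]
    exact Finset.sum_congr rfl fun σ _ => by ring

theorem wedgeRight_apply {m k l : ℕ} (a : Alt m k) (b : Alt m l) :
    wedgeRight k b a = wedgeAlt a b := rfl

theorem wedgeAlt_compLinearMap {m k l : ℕ} (a : Alt m k) (b : Alt m l) (g : Vec m →ₗ[ℝ] Vec m) :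
    (wedgeAlt a b).compLinearMap g = wedgeAlt (a.compLinearMap g) (b.compLinearMap g) := by
  ext v
  simp [wedgeAlt_apply]

/-- The coordinate covector `dx^i`. -/
def dxAlt {m : ℕ} (i : Fin m) : Alt m 1 :=
  AlternatingMap.ofSubsingleton ℝ _ _ 0 (LinearMap.proj i)

theorem dxAlt_apply {m : ℕ} (i : Fin m) (v : Fin 1 → Vec m) : dxAlt i v = v 0 i := rfl

/-- The exterior 2-form `Σ dq^μ ∧ dp_μ`. -/
def sympAlt {n : ℕ} : Alt (2 * n + 1) 2 :=
  ∑ μ : Fin n, wedgeAlt (dxAlt (qIdx μ)) (dxAlt (pIdx μ))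

theorem symp_eq_sympAlt {n : ℕ} (x : Vec (2 * n + 1)) (v : Fin 2 → Vec (2 * n + 1)) :
    symp x v = sympAlt v := by
  rw [sympAlt, alt_sum_apply, symp, Finset.sum_apply x, Finset.sum_apply v]
  exact Finset.sum_congr rfl fun μ _ =>
    wedge_eq_wedgeAlt (a := dxAlt (qIdx μ)) (b := dxAlt (pIdx μ)) (fun _ => rfl) (fun _ => rfl) v

theorem sympAlt_apply {n : ℕ} (v : Fin 2 → Vec (2 * n + 1)) :
    sympAlt v = ∑ μ : Fin n, (v 0 (qIdx μ) * v 1 (pIdx μ) - v 1 (qIdx μ) * v 0 (pIdx μ)) := by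
  simp only [sympAlt, alt_sum_apply]
  refine Finset.sum_congr rfl fun μ _ => ?_
  have h : (Finset.univ : Finset (Equiv.Perm (Fin (1 + 1)))) = {1, Equiv.swap 0 1} := by decide
  rw [wedgeAlt_apply, h, Finset.sum_pair (by decide)]
  simp [dxAlt_apply, Fin.natAdd, Fin.castAdd, Fin.castLE]
  ring

/-- The bottom operator on exterior forms. -/
def botAlt {n j : ℕ} : Alt (2 * n + 1) (j + 2) →ₗ[ℝ] Alt (2 * n + 1) j where
  toFun a := ∑ μ : Fin n, (a.curryLeft (basisVec (qIdx μ))).curryLeft (basisVec (pIdx μ))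
  map_add' a b := by simp [Finset.sum_add_distrib]
  map_smul' r a := by simp [Finset.smul_sum]

theorem botAlt_apply {n j : ℕ} (a : Alt (2 * n + 1) (j + 2)) (v : Fin j → Vec (2 * n + 1)) :
    botAlt a v = ∑ μ : Fin n,
      a (Fin.cons (basisVec (qIdx μ)) (Fin.cons (basisVec (pIdx μ)) v : Fin (j + 1) → _)) := by
  change (∑ μ : Fin n, (a.curryLeft (basisVec (qIdx μ))).curryLeft (basisVec (pIdx μ))) v = _
  rw [alt_sum_apply]
  rfl

theorem botOp_eq_botAlt {n j : ℕ} {ω : Form (2 * n + 1) (j + 2)} {x : Vec (2 * n + 1)}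
    {a : Alt (2 * n + 1) (j + 2)} (ha : ∀ v, ω x v = a v) (v : Fin j → Vec (2 * n + 1)) :
    botOp ω x v = botAlt a v := by
  simp only [botAlt_apply, ← ha, botOp]
  exact (congrFun (Finset.sum_apply x _ _) v).trans (Finset.sum_apply v _ _)

/-- The components of an exterior form in the standard basis. -/
def coeffs (m k : ℕ) : Alt m k →ₗ[ℝ] EuclideanSpace ℝ (Fin k → Fin m) where
  toFun a := WithLp.toLp 2 fun f => a fun i => basisVec (f i)
  map_add' _ _ := rfl
  map_smul' _ _ := rfl

theorem coeffs_apply {m k : ℕ} (a : Alt m k) (f : Fin k → Fin m) :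
    coeffs m k a f = a fun i => basisVec (f i) := rfl

theorem alt_ext_basisVec {m k : ℕ} {a b : Alt m k}
    (h : ∀ f : Fin k → Fin m, (a fun i => basisVec (f i)) = b fun i => basisVec (f i)) :
    a = b := by
  refine AlternatingMap.coe_multilinearMap_injective
    (Module.Basis.ext_multilinear (fun _ => Pi.basisFun ℝ (Fin m)) fun f => ?_)
  simpa [basisVec] using h f

theorem coeffs_injective (m k : ℕ) : Function.Injective (coeffs m k) := fun _ _ h =>
  alt_ext_basisVec fun f => congrArg (fun z : EuclideanSpace ℝ (Fin k → Fin m) => z f) h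

theorem inner_coeffs {m k : ℕ} (a b : Alt m k) :
    ⟪coeffs m k a, coeffs m k b⟫_ℝ =
      ∑ f : Fin k → Fin m, (a fun i => basisVec (f i)) * b fun i => basisVec (f i) := by
  simp [PiLp.inner_apply, coeffs_apply, mul_comm]

theorem alt_snoc {m k : ℕ} (a : Alt m (k + 1)) (g : Fin k → Vec m) (w : Vec m) :
    a (Fin.snoc g w : Fin (k + 1) → Vec m) =
      (-1) ^ k * a (Fin.cons w g : Fin (k + 1) → Vec m) := by
  have h := a.map_perm (Fin.cons w g : Fin (k + 1) → Vec m) (finRotate _)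
  rw [sign_finRotate] at h
  rw [Fin.snoc_eq_cons_rotate]
  simpa [Function.comp_def, Units.smul_def] using h

theorem alt_append_pair {m k : ℕ} (a : Alt m (k + 2)) (g : Fin k → Vec m) (w w' : Vec m) :
    a (Fin.append g ![w, w']) =
      a (Fin.cons w (Fin.cons w' g : Fin (k + 1) → Vec m) : Fin (k + 2) → Vec m) := by
  have h : Fin.append g ![w, w'] = Fin.snoc (Fin.snoc g w : Fin (k + 1) → Vec m) w' := by
    funext i
    refine Fin.addCases (fun i => ?_) (fun i => ?_) i
    · rw [Fin.append_left]
      exact ((Fin.snoc_castSucc (α := fun _ => Vec m) _ _ i.castSucc).trans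
        (Fin.snoc_castSucc (α := fun _ => Vec m) _ _ i)).symm
    · rw [Fin.append_right]
      fin_cases i
      · exact ((Fin.snoc_castSucc (α := fun _ => Vec m) _ _ (Fin.last k)).trans
          (Fin.snoc_last (α := fun _ => Vec m) _ _)).symm
      · exact (Fin.snoc_last (α := fun _ => Vec m) _ _).symm
  rw [h, alt_snoc, Fin.cons_snoc_eq_snoc_cons, alt_snoc, ← mul_assoc, ← pow_add]
  simp [Even.neg_one_pow (Even.add_self (k + 1))]

theorem sum_alt_mul_wedgeAlt {m k l : ℕ} (c : Alt m (k + l)) (a : Alt m k) (b : Alt m l) :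
    ∑ f : Fin (k + l) → Fin m,
        (c fun i => basisVec (f i)) * wedgeAlt a b (fun i => basisVec (f i)) =
      ((k.factorial * l.factorial : ℕ) : ℝ)⁻¹ * (k + l).factorial *
        ∑ g : Fin k → Fin m, ∑ h : Fin l → Fin m,
          c (Fin.append (fun i => basisVec (g i)) fun i => basisVec (h i)) *
            ((a fun i => basisVec (g i)) * b fun i => basisVec (h i)) := by
  set T : (Fin (k + l) → Fin m) → ℝ := fun f => (c fun i => basisVec (f i)) *
    ((a fun i => basisVec (f (Fin.castAdd l i))) * b fun i => basisVec (f (Fin.natAdd k i)))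
  have hperm : ∀ (f : Fin (k + l) → Fin m) (σ : Equiv.Perm (Fin (k + l))),
      (c fun i => basisVec (f i)) * (((Equiv.Perm.sign σ : ℤ) : ℝ) *
        (a fun i => basisVec (f (σ (Fin.castAdd l i)))) *
        (b fun j => basisVec (f (σ (Fin.natAdd k j))))) = T (f ∘ σ) := fun f σ => by
    have h := c.map_perm (fun i => basisVec (f i)) σ
    simp only [Units.smul_def, zsmul_eq_mul, Function.comp_def] at h
    simp only [T, Function.comp_apply, h]
    ring
  have hsum : ∀ σ : Equiv.Perm (Fin (k + l)), ∑ f, T (f ∘ σ) = ∑ f, T f := fun σ =>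
    Equiv.sum_comp (Equiv.arrowCongr σ.symm (Equiv.refl (Fin m))) T
  have hsplit : ∑ f, T f = ∑ g : Fin k → Fin m, ∑ h : Fin l → Fin m, T (Fin.append g h) := by
    rw [← Fintype.sum_prod_type' (f := fun g h => T (Fin.append g h))]
    exact (Equiv.sum_comp (Fin.appendEquiv k l) T).symm
  have happ : ∀ (g : Fin k → Fin m) (h : Fin l → Fin m),
      (fun i => (basisVec (Fin.append g h i) : Vec m)) =
        Fin.append (fun i => basisVec (g i)) fun i => basisVec (h i) := fun g h => by
    funext i
    refine Fin.addCases (fun i => ?_) (fun i => ?_) i <;> simp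
  calc _ = ∑ f : Fin (k + l) → Fin m, ((k.factorial * l.factorial : ℕ) : ℝ)⁻¹ *
        ∑ σ : Equiv.Perm (Fin (k + l)), T (f ∘ σ) := by
        refine Finset.sum_congr rfl fun f _ => ?_
        rw [wedgeAlt_apply, mul_left_comm, Finset.mul_sum]
        simp only [hperm]
    _ = ((k.factorial * l.factorial : ℕ) : ℝ)⁻¹ * (k + l).factorial * ∑ f, T f := by
        rw [← Finset.mul_sum, Finset.sum_comm]
        simp [hsum, Fintype.card_perm, mul_assoc]
    _ = _ := by
        rw [hsplit]
        simp [T, happ]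

theorem sum_alt_mul_sympAlt {n j : ℕ} (c : Alt (2 * n + 1) (j + 2))
    (g : Fin j → Vec (2 * n + 1)) :
    ∑ h : Fin 2 → Fin (2 * n + 1),
        c (Fin.append g fun i => basisVec (h i)) * sympAlt (fun i => basisVec (h i)) =
      2 * botAlt c g := by
  have hb : ∀ h : Fin 2 → Fin (2 * n + 1),
      (fun i => (basisVec (h i) : Vec (2 * n + 1))) = ![basisVec (h 0), basisVec (h 1)] :=
    fun h => by funext i; fin_cases i <;> rfl
  have hswap : ∀ w w' : Vec (2 * n + 1),
      c (Fin.cons w' (Fin.cons w g : Fin (j + 1) → _) : Fin (j + 2) → _) =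
        -c (Fin.cons w (Fin.cons w' g : Fin (j + 1) → _) : Fin (j + 2) → _) := fun w w' => by
    rw [← c.map_swap _ (show (0 : Fin (j + 2)) ≠ 1 from Fin.zero_ne_one)]
    congr 1
    funext i
    refine Fin.cases ?_ (fun i => Fin.cases ?_ (fun i => ?_) i) i
    · simp
    · simp
    · have h0 : (i.succ.succ : Fin (j + 2)) ≠ 0 := Fin.succ_ne_zero _
      have h1 : (i.succ.succ : Fin (j + 2)) ≠ 1 :=
        fun h => Fin.succ_ne_zero i (Fin.succ_injective _ h)
      simp [Equiv.swap_apply_of_ne_of_ne h0 h1]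
  rw [← Equiv.sum_comp (finTwoArrowEquiv (Fin (2 * n + 1))).symm, Fintype.sum_prod_type]
  simp only [hb, alt_append_pair, sympAlt_apply, botAlt_apply, Finset.mul_sum]
  simp only [finTwoArrowEquiv_symm_apply, Matrix.cons_val_zero, Matrix.cons_val_one]
  rw [Finset.sum_congr rfl fun i _ => Finset.sum_comm, Finset.sum_comm]
  refine Finset.sum_congr rfl fun μ _ => ?_
  simp only [basisVec, Pi.single_apply, mul_sub, Finset.sum_sub_distrib, mul_ite,
    mul_one, mul_zero, Finset.sum_ite_eq, Finset.sum_ite_irrel, Finset.sum_const_zero,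
    Finset.mem_univ, if_true]
  rw [hswap (Pi.single (qIdx μ) 1)]
  ring

/-- Wedging with `Ω` is, up to a positive factor, adjoint to the bottom operator. -/
theorem inner_coeffs_wedgeAlt_sympAlt (n j : ℕ) : ∃ r : ℝ, 0 < r ∧
    ∀ (c : Alt (2 * n + 1) (j + 2)) (a : Alt (2 * n + 1) j),
      ⟪coeffs _ _ c, coeffs _ _ (wedgeAlt a sympAlt)⟫_ℝ =
        r * ⟪coeffs _ _ (botAlt c), coeffs _ _ a⟫_ℝ := by
  refine ⟨((j.factorial * Nat.factorial 2 : ℕ) : ℝ)⁻¹ * (j + 2).factorial * 2, by positivity,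
    fun c a => ?_⟩
  rw [inner_coeffs, inner_coeffs, sum_alt_mul_wedgeAlt, mul_assoc _ (2 : ℝ)]
  congr 1
  rw [Finset.mul_sum]
  refine Finset.sum_congr rfl fun g _ => ?_
  rw [← mul_assoc, ← sum_alt_mul_sympAlt, Finset.sum_mul]
  exact Finset.sum_congr rfl fun h _ => by ring

/-- The primitive part of `a` is obtained by subtracting `T a ∧ Ω`, where `T` is linear in the
coefficients of `a`. -/
theorem exists_linear_botAlt_sub_eq_zero (n j : ℕ) :
    ∃ T : EuclideanSpace ℝ (Fin (j + 2) → Fin (2 * n + 1)) →ₗ[ℝ] Alt (2 * n + 1) j,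
      ∀ a : Alt (2 * n + 1) (j + 2), botAlt (a - wedgeAlt (T (coeffs _ _ a)) sympAlt) = 0 := by
  obtain ⟨r, hr, hadj⟩ := inner_coeffs_wedgeAlt_sympAlt n j
  set L := (coeffs (2 * n + 1) (j + 2)).comp (wedgeRight j sympAlt)
  obtain ⟨R, hR⟩ := L.rangeRestrict.exists_rightInverse_of_surjective L.range_rangeRestrict
  refine ⟨R.comp (LinearMap.range L).orthogonalProjectionOnto.toLinearMap, fun a => ?_⟩
  set z := (LinearMap.range L).orthogonalProjectionOnto (coeffs _ _ a)
  have hLz : coeffs _ _ (wedgeAlt (R z) sympAlt) = z :=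
    congrArg Subtype.val (LinearMap.congr_fun hR z)
  have h := hadj (a - wedgeAlt (R z) sympAlt) (botAlt (a - wedgeAlt (R z) sympAlt))
  have h0 := (LinearMap.range L).starProjection_inner_eq_zero (coeffs _ _ a)
    (L (botAlt (a - wedgeAlt (R z) sympAlt))) (LinearMap.mem_range_self _ _)
  rw [map_sub, hLz] at h
  have h1 := h.symm.trans h0
  rw [mul_eq_zero, inner_self_eq_zero] at h1
  exact coeffs_injective _ _ ((h1.resolve_left hr.ne').trans (map_zero _).symm)

theorem wedgeAlt_sympAlt_eq_zero_of_botAlt {n j : ℕ} (a : Alt (2 * n + 1) j)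
    (h : botAlt (wedgeAlt a sympAlt) = 0) : wedgeAlt a sympAlt = 0 := by
  obtain ⟨r, -, hadj⟩ := inner_coeffs_wedgeAlt_sympAlt n j
  have h1 := hadj (wedgeAlt a sympAlt) a
  rw [h, map_zero, inner_zero_left, mul_zero, inner_self_eq_zero] at h1
  exact coeffs_injective _ _ (h1.trans (map_zero _).symm)

/-- The projection of `ℝ^{2n+1}` along `∂/∂u` onto `{u = 0}`. -/
def dropU (n : ℕ) : Vec (2 * n + 1) →ₗ[ℝ] Vec (2 * n + 1) :=
  LinearMap.id - (LinearMap.proj uIdx).smulRight chi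

theorem dropU_apply {n : ℕ} (v : Vec (2 * n + 1)) : dropU n v = v - v uIdx • chi := rfl

theorem dropU_chi {n : ℕ} : dropU n chi = 0 := by
  simp [dropU_apply, chi, basisVec]

theorem dropU_basisVec {n : ℕ} {i : Fin (2 * n + 1)} (hi : i ≠ uIdx) :
    dropU n (basisVec i) = basisVec i := by
  simp [dropU_apply, basisVec, hi.symm]

theorem qIdx_ne_uIdx {n : ℕ} (μ : Fin n) : qIdx μ ≠ uIdx := by
  simp only [qIdx, uIdx, ne_eq, Fin.mk.injEq]; omega

theorem pIdx_ne_uIdx {n : ℕ} (μ : Fin n) : pIdx μ ≠ uIdx := by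
  simp only [pIdx, uIdx, ne_eq, Fin.mk.injEq]; omega

theorem sympAlt_compLinearMap_dropU {n : ℕ} : sympAlt.compLinearMap (dropU n) = sympAlt := by
  ext v
  simp [sympAlt_apply, dropU_apply, chi, basisVec, qIdx_ne_uIdx, pIdx_ne_uIdx]

theorem botAlt_compLinearMap_dropU {n j : ℕ} (a : Alt (2 * n + 1) (j + 2)) :
    botAlt (a.compLinearMap (dropU n)) = (botAlt a).compLinearMap (dropU n) := by
  ext v
  rw [AlternatingMap.compLinearMap_apply, botAlt_apply, botAlt_apply]
  refine Finset.sum_congr rfl fun μ _ => ?_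
  rw [AlternatingMap.compLinearMap_apply]
  congr 1
  funext i
  refine Fin.cases ?_ (fun i => Fin.cases ?_ (fun i => ?_) i) i <;>
    simp [dropU_basisVec, qIdx_ne_uIdx, pIdx_ne_uIdx]

theorem alt_eq_zero_of_apply_eq {m k : ℕ} {a : Alt m (k + 1)} {w : Vec m}
    (ha : ∀ v : Fin k → Vec m, a (Fin.cons w v : Fin (k + 1) → Vec m) = 0)
    {v : Fin (k + 1) → Vec m} {i : Fin (k + 1)} (hi : v i = w) : a v = 0 := by
  have h := a.map_perm v (Equiv.swap 0 i)
  have h0 : v ∘ Equiv.swap 0 i = Fin.cons w (Fin.tail (v ∘ Equiv.swap 0 i)) := by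
    rw [← Fin.cons_self_tail (v ∘ Equiv.swap 0 i)]
    simp [hi]
  rw [h0, ha] at h
  rcases Int.units_eq_one_or (Equiv.Perm.sign (Equiv.swap 0 i)) with h1 | h1 <;>
    simpa [h1] using h.symm

theorem compLinearMap_dropU_eq_self {n k : ℕ} {a : Alt (2 * n + 1) (k + 1)}
    (ha : ∀ v : Fin k → Vec (2 * n + 1), a (Fin.cons chi v : Fin (k + 1) → Vec (2 * n + 1)) = 0) :
    a.compLinearMap (dropU n) = a := by
  refine alt_ext_basisVec fun f => ?_
  rw [AlternatingMap.compLinearMap_apply]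
  by_cases hf : ∃ i, f i = uIdx
  · obtain ⟨i, hi⟩ := hf
    rw [alt_eq_zero_of_apply_eq (v := fun i => basisVec (f i)) ha (i := i) (by rw [hi]; rfl)]
    exact a.map_coord_zero i ((congrArg (fun t => dropU n (basisVec t)) hi).trans dropU_chi)
  · push Not at hf
    simp only [dropU_basisVec (hf _)]

theorem iprod_chi_eq_zero {n k : ℕ} {ω : Form (2 * n + 1) k}
    {a : Vec (2 * n + 1) → Alt (2 * n + 1) k}
    (h : ∀ x v, ω x v = (a x).compLinearMap (dropU n) v) : iprod chi ω = 0 := by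
  cases k with
  | zero => rfl
  | succ k =>
    funext x v
    change ω x (Fin.cons chi v) = 0
    rw [h]
    exact (a x).map_coord_zero 0 dropU_chi

theorem SmoothForm.wedge {m k l : ℕ} {ω : Form m k} {η : Form m l} (hω : SmoothForm ω)
    (hη : SmoothForm η) : SmoothForm (wedge ω η) := fun v => by
  unfold MA.wedge
  exact contDiff_const.mul (ContDiff.sum fun σ _ => (contDiff_const.mul (hω _)).mul (hη _))

theorem smoothForm_symp {n : ℕ} : SmoothForm (symp (n := n)) := fun v => by
  simp only [symp_eq_sympAlt]
  exact contDiff_const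

/-- Hodge–Lepage decomposition.  Every `k`-form `ω` (2 ≤ k ≤ n) on ℝ^{2n+1}
with `χ ⌟ ω = 0` can be written as `ω = ω_ε + x ∧ Ω` with `ω_ε` effective and `χ ⌟ x = 0`;
the effective part `ω_ε` is unique. -/
theorem hodge_lepage (n k : ℕ) (hk2 : 2 ≤ k) (hkn : k ≤ n)
    (ω : Form (2 * n + 1) k) (hω : IsForm ω) (hωs : SmoothForm ω)
    (hχ : iprod (chi (n := n)) ω = 0) :
    ∃ (x : Form (2 * n + 1) (k - 2)) (ωε : Form (2 * n + 1) k),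
      IsForm x ∧ SmoothForm x ∧ iprod (chi (n := n)) x = 0 ∧
      IsForm ωε ∧ SmoothForm ωε ∧ iprod (chi (n := n)) ωε = 0 ∧ botOp ωε = 0 ∧
      ω = ωε + reindex (show k - 2 + 2 = k by omega) (wedge x (symp (n := n))) ∧
      ∀ (x' : Form (2 * n + 1) (k - 2)) (ωε' : Form (2 * n + 1) k),
        IsForm x' → SmoothForm x' → iprod (chi (n := n)) x' = 0 →
        IsForm ωε' → SmoothForm ωε' → iprod (chi (n := n)) ωε' = 0 → botOp ωε' = 0 →
        ω = ωε' + reindex (show k - 2 + 2 = k by omega) (wedge x' (symp (n := n))) →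
        ωε' = ωε := by
  obtain ⟨j, rfl⟩ : ∃ j, k = j + 2 := ⟨k - 2, by omega⟩
  choose a ha using hω
  obtain ⟨T, hT⟩ := exists_linear_botAlt_sub_eq_zero n j
  set y : Vec (2 * n + 1) → Alt (2 * n + 1) j :=
    fun p => (T (coeffs _ _ (a p))).compLinearMap (dropU n)
  set x : Form (2 * n + 1) j := fun p v => y p v
  have hLy (p) : wedgeAlt (y p) sympAlt =
      (wedgeAlt (T (coeffs _ _ (a p))) sympAlt).compLinearMap (dropU n) := by
    rw [wedgeAlt_compLinearMap, sympAlt_compLinearMap_dropU]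
  have hwedge (p v) : wedge x symp p v = wedgeAlt (y p) sympAlt v :=
    wedge_eq_wedgeAlt (fun _ => rfl) (symp_eq_sympAlt p) v
  have hproj (p) : (a p).compLinearMap (dropU n) = a p :=
    compLinearMap_dropU_eq_self fun v => by
      rw [← ha]
      exact congrFun (congrFun hχ p) v
  set ε : Form (2 * n + 1) (j + 2) := ω - wedge x symp
  have hε (p v) : ε p v = (a p - wedgeAlt (y p) sympAlt) v := by
    simp only [ε, Pi.sub_apply, ha, hwedge, AlternatingMap.sub_apply]
  have hεproj (p) : a p - wedgeAlt (y p) sympAlt =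
      (a p - wedgeAlt (T (coeffs _ _ (a p))) sympAlt).compLinearMap (dropU n) := by
    rw [hLy]
    nth_rewrite 1 [← hproj p]
    rfl
  have hbot (p) : botAlt (a p - wedgeAlt (y p) sympAlt) = 0 := by
    rw [hεproj, botAlt_compLinearMap_dropU, hT, AlternatingMap.zero_compLinearMap]
  have hxs : SmoothForm x := fun v => by
    let ev : EuclideanSpace ℝ (Fin (j + 2) → Fin (2 * n + 1)) →ₗ[ℝ] ℝ :=
      { toFun := fun z => T z fun i => dropU n (v i)
        map_add' := fun z w => by simp
        map_smul' := fun r z => by simp }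
    have hc : ContDiff ℝ (⊤ : ℕ∞) fun p => coeffs _ _ (a p) := by
      rw [contDiff_euclidean]
      intro f
      simp only [coeffs_apply, ← ha]
      exact hωs _
    exact (LinearMap.toContinuousLinearMap ev).contDiff.comp hc
  refine ⟨x, ε, fun p => ⟨y p, fun _ => rfl⟩, hxs, iprod_chi_eq_zero fun _ _ => rfl,
    fun p => ⟨_, hε p⟩, fun v => (hωs v).sub (hxs.wedge smoothForm_symp v),
    iprod_chi_eq_zero fun p v => (hε p v).trans (by rw [hεproj]), ?_, ?_, ?_⟩
  · funext p v
    rw [botOp_eq_botAlt (hε p), hbot]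
    rfl
  · exact (sub_add_cancel ω _).symm
  · intro x' ε' hx' _ _ hε' _ _ hbot' hω'
    funext p v
    obtain ⟨b, hb⟩ : ∃ b : Alt (2 * n + 1) j, ∀ v, x' p v = b v := hx' p
    obtain ⟨e, he⟩ := hε' p
    have hsum : a p = e + wedgeAlt b sympAlt := by
      ext w
      rw [← ha, AlternatingMap.add_apply, ← he, ← wedge_eq_wedgeAlt hb (symp_eq_sympAlt p)]
      exact congrFun (congrFun hω' p) w
    have hbe : botAlt e = 0 := by
      ext w
      rw [← botOp_eq_botAlt he, hbot']
      rfl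
    have hdiff : e - (a p - wedgeAlt (y p) sympAlt) = wedgeAlt (y p - b) sympAlt := by
      rw [← wedgeRight_apply (y p - b), map_sub, wedgeRight_apply, wedgeRight_apply, hsum]
      abel
    have hzero := wedgeAlt_sympAlt_eq_zero_of_botAlt (y p - b)
      (by rw [← hdiff, map_sub, hbe, hbot, sub_zero])
    rw [he, hε, sub_eq_zero.mp (hdiff.trans hzero)]

end MA
end
end

section
/- Let ω₁ and ω₂ be n-forms on ℝ^{2n+1} with χ ⌟ ω₁ = χ ⌟ ω₂ = 0, and suppose there exists a nowhere-vanishing smooth function k on ℝ^{2n+1} such that (j¹φ)*(ω₁ − k·ω₂) = 0 for every smooth φ: ℝⁿ → ℝ (i.e. ω₁ and ω₂ determine the same Monge–Ampère equation). Then their effective parts satisfy ω₁ε = k·ω₂ε. -/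
noncomputable section

namespace MA

/-- Wedge product (from the left) of the covector `f` with a function on lists of vectors. -/
def extFun {W : Type*} (f : W → ℝ) : (List W → ℝ) → List W → ℝ
  | _, [] => 0
  | F, w :: l => f w * F l - extFun f (fun l' => F (w :: l')) l

theorem extFun_add {W : Type*} (f : W → ℝ) (F G : List W → ℝ) (l : List W) :
    extFun f (F + G) l = extFun f F l + extFun f G l := by
  induction l generalizing F G with
  | nil => simp [extFun]
  | cons w l ih =>
    have := ih (fun l' => F (w :: l')) (fun l' => G (w :: l'))
    simp only [extFun, Pi.add_apply] at this ⊢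
    rw [show (fun l' => F (w :: l') + G (w :: l')) =
      (fun l' => F (w :: l')) + fun l' => G (w :: l') from rfl, this]
    ring

theorem extFun_smul {W : Type*} (f : W → ℝ) (c : ℝ) (F : List W → ℝ) (l : List W) :
    extFun f (c • F) l = c * extFun f F l := by
  induction l generalizing F with
  | nil => simp [extFun]
  | cons w l ih =>
    have := ih (fun l' => F (w :: l'))
    simp only [extFun, Pi.smul_apply, smul_eq_mul] at this ⊢
    rw [show (fun l' => c * F (w :: l')) = c • fun l' => F (w :: l') from rfl, this]
    ring

/-- Functions on lists of vectors that change sign when two adjacent entries are exchanged.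
No linearity in the entries is required. -/
def altSubmodule (W : Type*) : Submodule ℝ (List W → ℝ) where
  carrier := {F | ∀ l a b l', F (l ++ a :: b :: l') = -F (l ++ b :: a :: l')}
  add_mem' {F G} hF hG l a b l' := by
    simp only [Pi.add_apply]; rw [hF, hG]; ring
  zero_mem' := by simp
  smul_mem' c F hF l a b l' := by
    simp only [Pi.smul_apply, smul_eq_mul]; rw [hF]; ring

/-- The space of alternating functions on lists of vectors. -/
def AltFun (W : Type*) : Type _ := altSubmodule W

instance (W : Type*) : AddCommGroup (AltFun W) := inferInstanceAs (AddCommGroup (altSubmodule W))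

instance (W : Type*) : Module ℝ (AltFun W) := inferInstanceAs (Module ℝ (altSubmodule W))

instance (W : Type*) : CoeFun (AltFun W) fun _ => List W → ℝ := ⟨fun F => F.1⟩

namespace AltFun

variable {W : Type*}

@[ext]
theorem ext_list {F G : AltFun W} (h : ∀ l, F l = G l) : F = G := Subtype.ext (funext h)

@[simp] theorem zero_apply (l : List W) : (0 : AltFun W) l = 0 := rfl
@[simp] theorem add_apply (F G : AltFun W) (l : List W) : (F + G) l = F l + G l := rfl
@[simp] theorem sub_apply (F G : AltFun W) (l : List W) : (F - G) l = F l - G l := rfl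
@[simp] theorem neg_apply (F : AltFun W) (l : List W) : (-F) l = -F l := rfl
@[simp] theorem smul_apply (c : ℝ) (F : AltFun W) (l : List W) : (c • F) l = c * F l := rfl

@[simp] theorem sum_apply {ι : Type*} (s : Finset ι) (F : ι → AltFun W) (l : List W) :
    (∑ i ∈ s, F i) l = ∑ i ∈ s, F i l :=
  map_sum (⟨⟨fun F : AltFun W => F l, rfl⟩, fun _ _ => rfl⟩ : AltFun W →+ ℝ) F s

end AltFun

/-- Contraction with the vector `w`. -/
def contr {W : Type*} (w : W) : Module.End ℝ (AltFun W) where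
  toFun F := ⟨fun l => F.1 (w :: l), fun l => F.2 (w :: l)⟩
  map_add' _ _ := rfl
  map_smul' _ _ := rfl

theorem extFun_mem {W : Type*} (f : W → ℝ) {F : List W → ℝ} (hF : F ∈ altSubmodule W) :
    extFun f F ∈ altSubmodule W := by
  intro l a b l'
  induction l generalizing F with
  | nil =>
    have h : (fun l' => F (a :: b :: l')) = (-1 : ℝ) • fun l' => F (b :: a :: l') := by
      funext l'
      simpa using hF [] a b l'
    simp only [List.nil_append, extFun]
    rw [h, extFun_smul]
    ring
  | cons w l ih =>
    have h1 := hF l a b l'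
    have h2 := ih (F := fun l' => F (w :: l')) fun l => hF (w :: l)
    simp only [List.cons_append, extFun, h1, h2]
    ring

/-- Wedge product with the covector `f`. -/
def ext {W : Type*} (f : W → ℝ) : Module.End ℝ (AltFun W) where
  toFun F := ⟨extFun f F.1, extFun_mem f F.2⟩
  map_add' F G := AltFun.ext_list fun l => extFun_add f F.1 G.1 l
  map_smul' c F := AltFun.ext_list fun l => extFun_smul f c F.1 l

theorem contr_apply {W : Type*} (w : W) (F : AltFun W) (l : List W) :
    (contr w F) l = F (w :: l) := rfl

theorem ext_apply_nil {W : Type*} (f : W → ℝ) (F : AltFun W) : (ext f F) [] = 0 := rfl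

theorem ext_apply_cons {W : Type*} (f : W → ℝ) (F : AltFun W) (w : W) (l : List W) :
    (ext f F) (w :: l) = f w * F l - ext f (contr w F) l := rfl

theorem contr_mul_contr {W : Type*} (v w : W) : contr v * contr w = -(contr w * contr v) := by
  refine LinearMap.ext fun F => AltFun.ext_list fun l => ?_
  exact F.2 [] w v l

theorem contr_mul_ext {W : Type*} (w : W) (f : W → ℝ) :
    contr w * ext f = f w • 1 - ext f * contr w := rfl

theorem ext_mul_ext {W : Type*} (f g : W → ℝ) : ext f * ext g = -(ext g * ext f) := by
  refine LinearMap.ext fun F => AltFun.ext_list fun l => ?_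
  induction l generalizing F with
  | nil => simp [Module.End.mul_apply, ext_apply_nil]
  | cons w l ih =>
    have key : ∀ f g : W → ℝ, ((ext f * ext g) F) (w :: l) =
        f w * (ext g F) l - g w * (ext f F) l + (ext f * ext g) (contr w F) l := by
      intro f g
      have h : contr w (ext g F) = g w • F - ext g (contr w F) := rfl
      simp only [Module.End.mul_apply, ext_apply_cons, h, map_sub, map_smul]
      simp
      ring
    have h2 := ih (contr w F)
    have h3 := key g f
    simp only [LinearMap.neg_apply, AltFun.neg_apply] at h2 ⊢
    rw [key, h3, h2]
    ring

theorem contr_mul_ext_mul_contr {W : Type*} (w b : W) (f : W → ℝ) :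
    contr w * (ext f * contr b) = ext f * contr b * contr w + f w • contr b := by
  rw [← mul_assoc, contr_mul_ext, sub_mul, smul_mul_assoc, one_mul, mul_assoc,
    contr_mul_contr w b, mul_neg, sub_neg_eq_add, mul_assoc, add_comm]

theorem ext_mul_contr_mul_ext {W : Type*} (b : W) (f g : W → ℝ) :
    ext g * contr b * ext f = ext f * (ext g * contr b) + f b • ext g := by
  rw [mul_assoc, contr_mul_ext, mul_sub, mul_smul_comm, mul_one, ← mul_assoc, ext_mul_ext g f,
    neg_mul, sub_neg_eq_add, mul_assoc, add_comm]

theorem contr_mul_ext_mul_ext {W : Type*} (w : W) (f g : W → ℝ) :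
    contr w * (ext f * ext g) = ext f * ext g * contr w + (f w • ext g - g w • ext f) := by
  rw [← mul_assoc, contr_mul_ext, sub_mul, smul_mul_assoc, one_mul, mul_assoc,
    contr_mul_ext, mul_sub, mul_smul_comm, mul_one, mul_assoc]
  abel

/-- Functions supported on lists of length `m`. -/
def HasDeg {W : Type*} (m : ℕ) (F : AltFun W) : Prop := ∀ l, l.length ≠ m → F l = 0

theorem HasDeg.contr {W : Type*} {m : ℕ} {F : AltFun W} (h : HasDeg (m + 1) F) (w : W) :
    HasDeg m (contr w F) := fun l hl => h _ (by simpa using hl)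

theorem HasDeg.contr_zero {W : Type*} {F : AltFun W} (h : HasDeg 0 F) (w : W) :
    MA.contr w F = 0 := AltFun.ext_list fun _ => h _ (by simp)

theorem HasDeg.ext {W : Type*} {m : ℕ} {F : AltFun W} (h : HasDeg m F) (f : W → ℝ) :
    HasDeg (m + 1) (ext f F) := by
  intro l hl
  induction l generalizing F m with
  | nil => rfl
  | cons w l ih =>
    have hl' : l.length ≠ m := by simpa using hl
    rw [ext_apply_cons, h l hl']
    cases m with
    | zero => rw [h.contr_zero w]; simp
    | succ m => rw [ih (h.contr w) hl']; ring

theorem HasDeg.add {W : Type*} {m : ℕ} {F G : AltFun W} (hF : HasDeg m F) (hG : HasDeg m G) :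
    HasDeg m (F + G) := fun l hl => by simp [hF l hl, hG l hl]

theorem HasDeg.sub {W : Type*} {m : ℕ} {F G : AltFun W} (hF : HasDeg m F) (hG : HasDeg m G) :
    HasDeg m (F - G) := fun l hl => by simp [hF l hl, hG l hl]

theorem HasDeg.smul {W : Type*} {m : ℕ} {F : AltFun W} (hF : HasDeg m F) (c : ℝ) :
    HasDeg m (c • F) := fun l hl => by simp [hF l hl]

theorem HasDeg.sum {W ι : Type*} {m : ℕ} (s : Finset ι) {F : ι → AltFun W}
    (hF : ∀ i, HasDeg m (F i)) : HasDeg m (∑ i ∈ s, F i) := by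
  intro l hl
  simp [fun i => hF i l hl]

theorem contr_contr_self {W : Type*} (w : W) (F : AltFun W) : contr w (contr w F) = 0 := by
  have := LinearMap.congr_fun (contr_mul_contr w w) F
  ext l
  have h : contr w (contr w F) l = -contr w (contr w F) l := congrArg (fun G => G l) this
  simp only [AltFun.zero_apply]
  linarith

theorem apply_of_perm {W : Type*} {l l' : List W} (h : l.Perm l') (F : AltFun W) :
    F l = F l' ∨ F l = -F l' := by
  induction h generalizing F with
  | nil => exact Or.inl rfl
  | cons a _ ih => exact ih (contr a F)
  | swap a b l => exact Or.inr (F.2 [] b a l)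
  | trans _ _ ih₁ ih₂ =>
    rcases ih₁ F with h₁ | h₁ <;> rcases ih₂ F with h₂ | h₂ <;> simp [h₁, h₂]

theorem apply_eq_zero_of_perm {W : Type*} {l l' : List W} (h : l.Perm l') {F : AltFun W}
    (hF : F l' = 0) : F l = 0 := by
  rcases apply_of_perm h F with h | h <;> simp [h, hF]

section Symplectic

variable {n : ℕ}

/-- The coordinate vector `∂/∂q^μ`. -/
def qv (μ : Fin n) : Vec (2 * n + 1) := basisVec (qIdx μ)

/-- The coordinate vector `∂/∂p_μ`. -/
def pv (μ : Fin n) : Vec (2 * n + 1) := basisVec (pIdx μ)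

/-- The coordinate function `q^μ`. -/
def qc (μ : Fin n) (w : Vec (2 * n + 1)) : ℝ := w (qIdx μ)

/-- The coordinate function `p_μ`. -/
def pc (μ : Fin n) (w : Vec (2 * n + 1)) : ℝ := w (pIdx μ)

@[simp] theorem qc_qv (μ ν : Fin n) : qc μ (qv ν) = if μ = ν then 1 else 0 := by
  simp [qc, qv, basisVec, qIdx, Pi.single_apply, Fin.ext_iff]

@[simp] theorem pc_pv (μ ν : Fin n) : pc μ (pv ν) = if μ = ν then 1 else 0 := by
  simp [pc, pv, basisVec, pIdx, Pi.single_apply, Fin.ext_iff]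

@[simp] theorem qc_pv (μ ν : Fin n) : qc μ (pv ν) = 0 := by
  have := μ.isLt
  simp [qc, pv, basisVec, qIdx, pIdx, Pi.single_apply, Fin.ext_iff]
  omega

@[simp] theorem pc_qv (μ ν : Fin n) : pc μ (qv ν) = 0 := by
  have := ν.isLt
  simp [pc, qv, basisVec, qIdx, pIdx, Pi.single_apply, Fin.ext_iff]
  omega

@[simp] theorem qc_add (μ : Fin n) (v w : Vec (2 * n + 1)) : qc μ (v + w) = qc μ v + qc μ w := rfl
@[simp] theorem pc_add (μ : Fin n) (v w : Vec (2 * n + 1)) : pc μ (v + w) = pc μ v + pc μ w := rfl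
@[simp] theorem qc_smul (μ : Fin n) (c : ℝ) (w : Vec (2 * n + 1)) : qc μ (c • w) = c * qc μ w := rfl
@[simp] theorem pc_smul (μ : Fin n) (c : ℝ) (w : Vec (2 * n + 1)) : pc μ (c • w) = c * pc μ w := rfl

@[simp] theorem qc_sum {ι : Type*} (μ : Fin n) (s : Finset ι) (w : ι → Vec (2 * n + 1)) :
    qc μ (∑ i ∈ s, w i) = ∑ i ∈ s, qc μ (w i) := by simp [qc]

@[simp] theorem pc_sum {ι : Type*} (μ : Fin n) (s : Finset ι) (w : ι → Vec (2 * n + 1)) :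
    pc μ (∑ i ∈ s, w i) = ∑ i ∈ s, pc μ (w i) := by simp [pc]

/-- The bottom operator on alternating functions. -/
def bot (n : ℕ) : Module.End ℝ (AltFun (Vec (2 * n + 1))) :=
  ∑ μ : Fin n, contr (pv μ) * contr (qv μ)

/-- The Lefschetz operator `Ω ∧ ·` on alternating functions. -/
def lef (n : ℕ) : Module.End ℝ (AltFun (Vec (2 * n + 1))) := ∑ μ : Fin n, ext (qc μ) * ext (pc μ)

/-- The number operator, equal to multiplication by `k` on `k`-linear forms killed by `χ`. -/
def num (n : ℕ) : Module.End ℝ (AltFun (Vec (2 * n + 1))) :=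
  ∑ μ : Fin n, (ext (qc μ) * contr (qv μ) + ext (pc μ) * contr (pv μ))

/-- Contraction with the linear expansion of `w` in the vectors `∂/∂q^μ`, `∂/∂p_μ`. -/
def linContr (w : Vec (2 * n + 1)) : Module.End ℝ (AltFun (Vec (2 * n + 1))) :=
  ∑ μ : Fin n, (qc μ w • contr (qv μ) + pc μ w • contr (pv μ))

theorem contr_mul_num (w : Vec (2 * n + 1)) :
    contr w * num n = num n * contr w + linContr w := by
  simp only [num, linContr, Finset.mul_sum, Finset.sum_mul, ← Finset.sum_add_distrib, mul_add,
    add_mul, contr_mul_ext_mul_contr]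
  exact Finset.sum_congr rfl fun _ _ => by abel

@[simp] theorem linContr_qv (μ : Fin n) : linContr (qv μ) = contr (qv μ) := by
  simp [linContr]

@[simp] theorem linContr_pv (μ : Fin n) : linContr (pv μ) = contr (pv μ) := by
  simp [linContr]

theorem bot_mul_num : bot n * num n = num n * bot n + (2 : ℝ) • bot n := by
  simp only [bot, Finset.sum_mul, Finset.mul_sum, Finset.smul_sum, ← Finset.sum_add_distrib]
  refine Finset.sum_congr rfl fun μ _ => ?_
  rw [mul_assoc, contr_mul_num, linContr_qv, mul_add, ← mul_assoc, contr_mul_num, linContr_pv,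
    add_mul, mul_assoc, two_smul]
  abel

theorem num_mul_ext (f : Vec (2 * n + 1) → ℝ) :
    num n * ext f =
      ext f * num n + ∑ μ : Fin n, (f (qv μ) • ext (qc μ) + f (pv μ) • ext (pc μ)) := by
  simp only [num, Finset.sum_mul, Finset.mul_sum, ← Finset.sum_add_distrib, mul_add,
    add_mul, ext_mul_contr_mul_ext]
  exact Finset.sum_congr rfl fun _ _ => by abel

theorem num_mul_ext_qc (μ : Fin n) : num n * ext (qc μ) = ext (qc μ) * num n + ext (qc μ) := by
  simp [num_mul_ext]

theorem num_mul_ext_pc (μ : Fin n) : num n * ext (pc μ) = ext (pc μ) * num n + ext (pc μ) := by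
  simp [num_mul_ext]

theorem num_mul_lef : num n * lef n = lef n * num n + (2 : ℝ) • lef n := by
  simp only [lef, Finset.sum_mul, Finset.mul_sum, Finset.smul_sum, ← Finset.sum_add_distrib]
  refine Finset.sum_congr rfl fun μ _ => ?_
  rw [← mul_assoc, num_mul_ext_qc, add_mul, mul_assoc, num_mul_ext_pc, mul_add, ← mul_assoc,
    two_smul]
  abel

theorem contr_mul_lef (w : Vec (2 * n + 1)) : contr w * lef n =
    lef n * contr w + ∑ μ : Fin n, (qc μ w • ext (pc μ) - pc μ w • ext (qc μ)) := by
  simp only [lef, Finset.sum_mul, Finset.mul_sum, ← Finset.sum_add_distrib, contr_mul_ext_mul_ext]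

theorem bot_mul_lef : bot n * lef n = lef n * bot n - num n + (n : ℝ) • 1 := by
  have h : ∀ μ : Fin n, contr (pv μ) * contr (qv μ) * lef n = lef n * (contr (pv μ) * contr (qv μ))
      - (ext (qc μ) * contr (qv μ) + ext (pc μ) * contr (pv μ)) + 1 := by
    intro μ
    have hq : contr (qv μ) * lef n = lef n * contr (qv μ) + ext (pc μ) := by simp [contr_mul_lef]
    have hp : contr (pv μ) * lef n = lef n * contr (pv μ) - ext (qc μ) := by
      simp [contr_mul_lef, sub_eq_add_neg]
    have h1 : contr (pv μ) * ext (pc μ) = 1 - ext (pc μ) * contr (pv μ) := by simp [contr_mul_ext]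
    rw [mul_assoc, hq, mul_add, ← mul_assoc, hp, h1, sub_mul, mul_assoc]
    abel
  simp only [bot, num, Finset.sum_mul, Finset.mul_sum, h, Finset.sum_add_distrib,
    Finset.sum_sub_distrib]
  simp [Nat.cast_smul_eq_nsmul]

theorem HasDeg.num {m : ℕ} {F : AltFun (Vec (2 * n + 1))} (h : HasDeg m F) :
    HasDeg m (num n F) := by
  cases m with
  | zero => simpa [MA.num, h.contr_zero] using h.smul 0
  | succ m =>
    simp only [MA.num, LinearMap.sum_apply, LinearMap.add_apply, Module.End.mul_apply]
    exact HasDeg.sum _ fun μ => ((h.contr _).ext _).add ((h.contr _).ext _)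

theorem HasDeg.lef {m : ℕ} {F : AltFun (Vec (2 * n + 1))} (h : HasDeg m F) :
    HasDeg (m + 2) (lef n F) := by
  simp only [MA.lef, LinearMap.sum_apply, Module.End.mul_apply]
  exact HasDeg.sum _ fun μ => (h.ext _).ext _

theorem HasDeg.bot {m : ℕ} {F : AltFun (Vec (2 * n + 1))} (h : HasDeg (m + 2) F) :
    HasDeg m (bot n F) := by
  simp only [MA.bot, LinearMap.sum_apply, Module.End.mul_apply]
  exact HasDeg.sum _ fun μ => (h.contr _).contr _

/-- The eigenvalues of the number operator in degree `m` are at most `m`. -/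
theorem HasDeg.eq_zero_of_num {m : ℕ} {F : AltFun (Vec (2 * n + 1))} (h : HasDeg m F) {c : ℝ}
    (hc : m < c) (hF : MA.num n F = c • F) : F = 0 := by
  induction m generalizing F c with
  | zero =>
    have : c • F = 0 := by simpa [MA.num, h.contr_zero] using hF.symm
    have hc0 : c ≠ 0 := by have : (0 : ℝ) < c := by simpa using hc
                           exact this.ne'
    exact (smul_eq_zero.mp this).resolve_left hc0
  | succ m ih =>
    have key : ∀ w : Vec (2 * n + 1), linContr w = MA.contr w → MA.contr w F = 0 := by
      intro w hw
      have h1 := LinearMap.congr_fun (contr_mul_num w) F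
      simp only [Module.End.mul_apply, LinearMap.add_apply, hw, hF, map_smul] at h1
      refine ih (h.contr w) (c := c - 1) (by push_cast at hc; linarith) ?_
      rw [sub_smul, one_smul, h1, add_sub_cancel_right]
    have h2 : c • F = 0 := by
      rw [← hF]
      simp [MA.num, key]
    have hc0 : c ≠ 0 := by
      push_cast at hc
      have : (0 : ℝ) ≤ m := Nat.cast_nonneg m
      linarith
    exact (smul_eq_zero.mp h2).resolve_left hc0

theorem HasDeg.bot_eq_zero {m : ℕ} {F : AltFun (Vec (2 * n + 1))} (h : HasDeg m F) (hm : m < 2) :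
    MA.bot n F = 0 := by
  ext l
  simp only [MA.bot, LinearMap.sum_apply, Module.End.mul_apply, AltFun.sum_apply, contr_apply,
    AltFun.zero_apply]
  exact Finset.sum_eq_zero fun μ _ => h _ (by simp; omega)

theorem HasDeg.eq_zero_of_lef_bot {m : ℕ} {F : AltFun (Vec (2 * n + 1))} (h : HasDeg m F)
    (hm : m ≤ n) {a c : ℝ} (ha : 0 < a) (hc : a * m < c)
    (hF : c • F - a • MA.num n F + MA.lef n (MA.bot n F) = 0) : F = 0 := by
  induction m using Nat.strong_induction_on generalizing F a c with
  | _ m ih =>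
    have hG : MA.bot n F = 0 := by
      rcases lt_or_ge m 2 with hm2 | hm2
      · exact h.bot_eq_zero hm2
      obtain ⟨m, rfl⟩ := Nat.exists_eq_add_of_le' hm2
      refine ih m (by omega) h.bot (by omega) (a := a + 1) (c := c - 2 * a + n) (by linarith) ?_ ?_
      · have : ((m + 2 : ℕ) : ℝ) ≤ n := by exact_mod_cast hm
        push_cast at this hc
        nlinarith
      · have h1 := congrArg (MA.bot n) hF
        have h2 := LinearMap.congr_fun (bot_mul_num (n := n)) F
        have h3 := LinearMap.congr_fun (bot_mul_lef (n := n)) (MA.bot n F)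
        simp only [Module.End.mul_apply, LinearMap.add_apply, LinearMap.sub_apply,
          LinearMap.smul_apply, Module.End.one_apply] at h2 h3
        simp only [map_add, map_sub, map_smul, map_zero, h2, h3] at h1
        rw [← h1]
        module
    rw [hG, map_zero, add_zero, sub_eq_zero] at hF
    refine h.eq_zero_of_num (c := c / a) (by rw [lt_div_iff₀ ha]; linarith) ?_
    rw [div_eq_inv_mul, mul_smul, hF, smul_smul, inv_mul_cancel₀ ha.ne', one_smul]

/-- The operator `⊥ ∘ (Ω ∧ ·)` is injective in degrees less than `n`. -/
theorem HasDeg.eq_zero_of_bot_lef {m : ℕ} {F : AltFun (Vec (2 * n + 1))} (h : HasDeg m F)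
    (hm : m < n) (hF : MA.bot n (MA.lef n F) = 0) : F = 0 := by
  refine h.eq_zero_of_lef_bot hm.le one_pos (c := n) (by simpa using hm) ?_
  have h3 := LinearMap.congr_fun (bot_mul_lef (n := n)) F
  simp only [Module.End.mul_apply, LinearMap.add_apply, LinearMap.sub_apply,
          LinearMap.smul_apply, Module.End.one_apply, hF] at h3
  rw [h3]
  module

/-- `F` is multilinear and vanishes when one of its arguments is `χ`. -/
def IsLin (F : AltFun (Vec (2 * n + 1))) : Prop := ∀ w, contr w F = linContr w F

theorem contr_mul_linContr (v w : Vec (2 * n + 1)) :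
    contr v * linContr w = -(linContr w * contr v) := by
  simp only [linContr, Finset.mul_sum, Finset.sum_mul, ← Finset.sum_neg_distrib]
  refine Finset.sum_congr rfl fun μ _ => ?_
  rw [mul_add, mul_smul_comm, mul_smul_comm, contr_mul_contr v, contr_mul_contr v, add_mul,
    smul_mul_assoc, smul_mul_assoc, smul_neg, smul_neg, neg_add]

theorem IsLin.contr {F : AltFun (Vec (2 * n + 1))} (h : IsLin F) (v : Vec (2 * n + 1)) :
    IsLin (MA.contr v F) := by
  intro w
  have h1 := LinearMap.congr_fun (contr_mul_contr w v) F
  have h2 := LinearMap.congr_fun (contr_mul_linContr v w) F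
  simp only [Module.End.mul_apply, LinearMap.neg_apply] at h1 h2
  rw [h1, h w, h2, neg_neg]

theorem IsLin.sub {F G : AltFun (Vec (2 * n + 1))} (hF : IsLin F) (hG : IsLin G) :
    IsLin (F - G) := fun w => by rw [map_sub, map_sub, hF w, hG w]

theorem IsLin.num_eq {m : ℕ} {F : AltFun (Vec (2 * n + 1))} (h : IsLin F) (hd : HasDeg m F) :
    MA.num n F = (m : ℝ) • F := by
  induction m generalizing F with
  | zero => simp [MA.num, hd.contr_zero]
  | succ m ih =>
    ext l
    cases l with
    | nil =>
      rw [hd.num [] (by simp), AltFun.smul_apply, hd [] (by simp), mul_zero]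
    | cons w l =>
      have h1 := LinearMap.congr_fun (contr_mul_num w) F
      simp only [Module.End.mul_apply, LinearMap.add_apply] at h1
      rw [ih (h.contr w) (hd.contr w), ← h w] at h1
      have h2 := congrArg (fun G : AltFun (Vec (2 * n + 1)) => G l) h1
      simp only [contr_apply, AltFun.add_apply, AltFun.smul_apply] at h2 ⊢
      rw [h2]
      push_cast
      ring

theorem HasDeg.isLin {m : ℕ} {F : AltFun (Vec (2 * n + 1))} (hd : HasDeg m F)
    (h : MA.num n F = (m : ℝ) • F) : IsLin F := by
  intro w
  rw [← sub_eq_zero]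
  have hcomm : (MA.contr w - linContr w) * MA.num n = MA.num n * (MA.contr w - linContr w) := by
    have h1 : linContr w * MA.num n = MA.num n * linContr w + linContr w := by
      have hq : ∀ μ : Fin n, MA.contr (qv μ) * MA.num n =
          MA.num n * MA.contr (qv μ) + MA.contr (qv μ) := by simp [contr_mul_num]
      have hp : ∀ μ : Fin n, MA.contr (pv μ) * MA.num n =
          MA.num n * MA.contr (pv μ) + MA.contr (pv μ) := by simp [contr_mul_num]
      simp only [linContr, Finset.sum_mul, Finset.mul_sum, ← Finset.sum_add_distrib, add_mul,
        mul_add, smul_mul_assoc, mul_smul_comm, hq, hp]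
      exact Finset.sum_congr rfl fun μ _ => by module
    rw [sub_mul, mul_sub, contr_mul_num, h1]
    abel
  cases m with
  | zero => simp [linContr, hd.contr_zero]
  | succ m =>
    have hdeg : HasDeg m ((MA.contr w - linContr w) F) := by
      simp only [linContr, LinearMap.sub_apply, LinearMap.sum_apply, LinearMap.add_apply,
        LinearMap.smul_apply]
      exact (hd.contr w).sub
        (HasDeg.sum _ fun μ => ((hd.contr _).smul _).add ((hd.contr _).smul _))
    refine hdeg.eq_zero_of_num (c := (m + 1 : ℕ)) (by push_cast; linarith) ?_
    have := LinearMap.congr_fun hcomm F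
    simp only [Module.End.mul_apply, h, map_smul] at this
    exact this.symm

/-- In degree `n`, an alternating function annihilated by `⊥` that differs from a form by a multiple
of `Ω` is itself a form. -/
theorem isLin_of_bot_eq_zero {m : ℕ} {E G F : AltFun (Vec (2 * n + 1))} (hn : m + 2 = n)
    (hE : IsLin E) (hdE : HasDeg n E) (hdF : HasDeg m F) (hdG : HasDeg n G)
    (hG : bot n G = 0) (h : E = G + lef n F) : IsLin G := by
  refine hdG.isLin ?_
  set F' := num n F - (m : ℝ) • F with hF'
  have h1 : num n G - (n : ℝ) • G = -lef n F' := by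
    have h2 := hE.num_eq hdE
    have h3 := LinearMap.congr_fun (num_mul_lef (n := n)) F
    have h4 : (n : ℝ) = m + 2 := by rw [← hn]; push_cast; ring
    simp only [Module.End.mul_apply, LinearMap.add_apply, LinearMap.smul_apply] at h3
    rw [h, map_add, h3] at h2
    rw [hF', map_sub, map_smul]
    have h5 : num n G = (n : ℝ) • (G + lef n F) - (lef n (num n F) + (2 : ℝ) • lef n F) := by
      rw [← h2]; abel
    rw [h5, h4]
    module
  have h2 : bot n (lef n F') = 0 := by
    have h3 := LinearMap.congr_fun (bot_mul_num (n := n)) G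
    simp only [Module.End.mul_apply, LinearMap.add_apply, LinearMap.smul_apply, hG, map_zero,
      smul_zero, add_zero] at h3
    have h4 := congrArg (bot n) h1
    rw [map_sub, h3, map_smul, hG, smul_zero, sub_zero, map_neg] at h4
    exact neg_eq_zero.mp h4.symm
  have h3 : F' = 0 := (hdF.num.sub (hdF.smul _)).eq_zero_of_bot_lef (by omega) h2
  rw [h3, map_zero, neg_zero] at h1
  exact sub_eq_zero.mp h1

/-- The symplectic form `Ω` on tangent vectors. -/
def sform (v w : Vec (2 * n + 1)) : ℝ := ∑ μ : Fin n, (qc μ v * pc μ w - pc μ v * qc μ w)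

theorem sum_ext_apply_eq_zero {W ι : Type*} (s : Finset ι) (a b : ι → ℝ) (f g : ι → W → ℝ)
    (l : List W) (h : ∀ w ∈ l, ∑ i ∈ s, (a i * f i w - b i * g i w) = 0) (F : AltFun W) :
    ∑ i ∈ s, (a i * ext (f i) F l - b i * ext (g i) F l) = 0 := by
  induction l generalizing F with
  | nil => simp [ext_apply_nil]
  | cons w l ih =>
    have h1 := ih (fun v hv => h v (by simp [hv])) (contr w F)
    have h2 := h w (by simp)
    calc _ = (∑ i ∈ s, (a i * f i w - b i * g i w)) * F l
        - ∑ i ∈ s, (a i * ext (f i) (contr w F) l - b i * ext (g i) (contr w F) l) := by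
          rw [Finset.sum_mul, ← Finset.sum_sub_distrib]
          refine Finset.sum_congr rfl fun i _ => ?_
          simp only [ext_apply_cons]
          ring
      _ = 0 := by rw [h1, h2]; ring

theorem lef_apply_of_isotropic (l : List (Vec (2 * n + 1)))
    (h : ∀ v ∈ l, ∀ w ∈ l, sform v w = 0) (F : AltFun (Vec (2 * n + 1))) : lef n F l = 0 := by
  induction l generalizing F with
  | nil => simp [lef, ext_apply_nil]
  | cons w l ih =>
    have h1 := congrArg (fun G : AltFun (Vec (2 * n + 1)) => G l)
      (LinearMap.congr_fun (contr_mul_lef w) F)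
    have h2 := ih (fun v hv v' hv' => h v (by simp [hv]) v' (by simp [hv'])) (contr w F)
    have h3 := sum_ext_apply_eq_zero Finset.univ (fun μ => qc μ w) (fun μ => pc μ w) pc qc l
      (fun v hv => h w (by simp) v (by simp [hv])) F
    simp only [Module.End.mul_apply, LinearMap.add_apply, LinearMap.sum_apply, LinearMap.sub_apply,
      LinearMap.smul_apply, AltFun.add_apply, AltFun.sum_apply, AltFun.sub_apply,
      AltFun.smul_apply, contr_apply, h2, h3] at h1
    simpa using h1

theorem IsLin.contr_add_smul {F : AltFun (Vec (2 * n + 1))} (h : IsLin F)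
    (v w : Vec (2 * n + 1)) (t : ℝ) : MA.contr (v + t • w) F = MA.contr v F + t • MA.contr w F := by
  rw [h, h v, h w]
  simp only [linContr, LinearMap.sum_apply, LinearMap.add_apply, LinearMap.smul_apply, qc_add,
    pc_add, qc_smul, pc_smul, Finset.smul_sum, ← Finset.sum_add_distrib]
  exact Finset.sum_congr rfl fun μ _ => by module

/-- A multilinear function killed by `χ` only depends on the `q` and `p` coordinates. -/
theorem IsLin.apply_congr {F : AltFun (Vec (2 * n + 1))} (h : IsLin F) {ι : Type*} (I : List ι)
    (v w : ι → Vec (2 * n + 1)) (hq : ∀ i μ, qc μ (v i) = qc μ (w i))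
    (hp : ∀ i μ, pc μ (v i) = pc μ (w i)) : F (I.map v) = F (I.map w) := by
  induction I generalizing F with
  | nil => rfl
  | cons i I ih =>
    have h1 : MA.contr (v i) F = MA.contr (w i) F := by
      rw [h, h (w i)]
      simp only [linContr, hq, hp]
    have h2 := ih (h.contr (v i))
    rw [h1] at h2
    exact (congrArg (fun G : AltFun (Vec (2 * n + 1)) => G (I.map v)) h1).trans h2

/-- The basis vectors `∂/∂q^μ` and `∂/∂p_μ`. -/
def bas (x : Fin n × Bool) : Vec (2 * n + 1) := if x.2 then pv x.1 else qv x.1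

theorem IsLin.eq_zero {F : AltFun (Vec (2 * n + 1))} (h : IsLin F)
    (hF : ∀ l : List (Fin n × Bool), F (l.map bas) = 0) : F = 0 := by
  ext l
  induction l generalizing F with
  | nil => exact hF []
  | cons w l ih =>
    have h1 := congrArg (fun G : AltFun (Vec (2 * n + 1)) => G l) (h w)
    have hq : ∀ μ : Fin n, MA.contr (qv μ) F l = 0 := fun μ =>
      ih (h.contr _) fun l' => by simpa [bas, contr_apply] using hF ((μ, false) :: l')
    have hp : ∀ μ : Fin n, MA.contr (pv μ) F l = 0 := fun μ =>
      ih (h.contr _) fun l' => by simpa [bas, contr_apply] using hF ((μ, true) :: l')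
    simpa [linContr, hq, hp, contr_apply] using h1

/-- The vector `∂/∂q^i + Σ_j S_{ij} ∂/∂p_j`. -/
def graphVec (S : Fin n → Fin n → ℝ) (i : Fin n) : Vec (2 * n + 1) := qv i + ∑ j, S i j • pv j

theorem sform_graphVec {S : Fin n → Fin n → ℝ} (hS : ∀ i j, S i j = S j i) (i j : Fin n) :
    sform (graphVec S i) (graphVec S j) = 0 := by
  simp [sform, graphVec, Finset.sum_sub_distrib, hS i j]

/-- `F` vanishes on the Lagrangian graphs of all symmetric matrices supported on `R × R`. -/
def VanishOn (R : Finset (Fin n)) (F : AltFun (Vec (2 * n + 1))) : Prop :=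
  ∀ S : Fin n → Fin n → ℝ, (∀ i j, S i j = S j i) → (∀ i j, i ∉ R → S i j = 0) →
    ∀ I : List (Fin n), I.Nodup → (∀ i, i ∈ I ↔ i ∈ R) → F (I.map (graphVec S)) = 0

theorem VanishOn.contr_add_smul {R : Finset (Fin n)} {F : AltFun (Vec (2 * n + 1))}
    (hF : VanishOn R F) {a : Fin n} (ha : a ∈ R) (t : ℝ) :
    VanishOn (R.erase a) (contr (qv a + t • pv a) F) := by
  intro S hS hR I hI hIR
  have haI : a ∉ I := by simp [hIR]
  have h := hF (fun i j => S i j + if i = a ∧ j = a then t else 0)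
    (fun i j => by rw [hS i j]; simp only [and_comm])
    (fun i j hi => by
      have hia : i ≠ a := by rintro rfl; exact hi ha
      simp [hia, hR i j (by simp [hi])])
    (a :: I) (List.nodup_cons.mpr ⟨haI, hI⟩)
    (fun i => by
      by_cases hia : i = a
      · simp [hia, ha]
      · simp [hia, hIR])
  rw [List.map_cons] at h
  have h1 : graphVec (fun i j => S i j + if i = a ∧ j = a then t else 0) a = qv a + t • pv a := by
    simp [graphVec, hR a _ (Finset.notMem_erase a R), ite_smul]
  have h2 : I.map (graphVec fun i j => S i j + if i = a ∧ j = a then t else 0)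
      = I.map (graphVec S) := by
    refine List.map_congr_left fun i hi => ?_
    have hia : i ≠ a := by rintro rfl; exact haI hi
    simp [graphVec, hia]
  rwa [h1, h2] at h

theorem VanishOn.contr_bas {R : Finset (Fin n)} {F : AltFun (Vec (2 * n + 1))}
    (hF : VanishOn R F) (hl : IsLin F) {a : Fin n} (ha : a ∈ R) (s : Bool) :
    VanishOn (R.erase a) (contr (bas (a, s)) F) := by
  intro S hS hR I hI hIR
  have h0 := hF.contr_add_smul ha 0 S hS hR I hI hIR
  have h1 := hF.contr_add_smul ha 1 S hS hR I hI hIR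
  rw [hl.contr_add_smul] at h0 h1
  simp only [AltFun.add_apply, AltFun.smul_apply, zero_mul, add_zero, one_mul] at h0 h1
  cases s
  · simpa [bas] using h0
  · simpa [bas, h0] using h1

/-- Contraction with the bivector `∂/∂q^a ∧ ∂/∂p_a`. -/
def pairContr (a : Fin n) : Module.End ℝ (AltFun (Vec (2 * n + 1))) := contr (pv a) * contr (qv a)

theorem VanishOn.contr_pair {R : Finset (Fin n)} {F : AltFun (Vec (2 * n + 1))}
    (hF : VanishOn R F) {a b : Fin n} (ha : a ∈ R) (hb : b ∈ R) (hab : a ≠ b) (t : ℝ) :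
    VanishOn ((R.erase a).erase b)
      (contr (qv b + t • pv a) (contr (qv a + t • pv b) F)) := by
  intro S hS hR I hI hIR
  have haI : a ∉ I := by simp [hIR]
  have hbI : b ∉ I := by simp [hIR]
  have h := hF (fun i j => S i j + if (i = a ∧ j = b) ∨ (i = b ∧ j = a) then t else 0)
    (fun i j => by
      rw [hS i j]
      congr 2
      apply propext
      tauto)
    (fun i j hi => by
      have hia : i ≠ a := by rintro rfl; exact hi ha
      have hib : i ≠ b := by rintro rfl; exact hi hb
      simp [hia, hib, hR i j (by simp [hi])])
    (a :: b :: I) (by simp [hI, haI, hbI, hab])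
    (fun i => by
      by_cases hia : i = a
      · simp [hia, ha]
      · by_cases hib : i = b
        · simp [hib, hb]
        · simp [hia, hib, hIR])
  rw [List.map_cons, List.map_cons] at h
  have h1 : graphVec (fun i j => S i j + if (i = a ∧ j = b) ∨ (i = b ∧ j = a) then t else 0) a
      = qv a + t • pv b := by
    simp [graphVec, hR a _ (by simp), ite_smul, hab]
  have h1' : graphVec (fun i j => S i j + if (i = a ∧ j = b) ∨ (i = b ∧ j = a) then t else 0) b
      = qv b + t • pv a := by
    simp [graphVec, hR b _ (by simp), ite_smul, hab.symm]
  have h2 : I.map (graphVec fun i j => S i j + if (i = a ∧ j = b) ∨ (i = b ∧ j = a) then t else 0)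
      = I.map (graphVec S) := by
    refine List.map_congr_left fun i hi => ?_
    have hia : i ≠ a := by rintro rfl; exact haI hi
    have hib : i ≠ b := by rintro rfl; exact hbI hi
    simp [graphVec, hia, hib]
  rwa [h1, h1', h2] at h

theorem VanishOn.pairContr_sub {R : Finset (Fin n)} {F : AltFun (Vec (2 * n + 1))}
    (hF : VanishOn R F) (hl : IsLin F) {a b : Fin n} (ha : a ∈ R) (hb : b ∈ R) (hab : a ≠ b) :
    VanishOn ((R.erase a).erase b) (pairContr a F - pairContr b F) := by
  intro S hS hR I hI hIR
  have key : ∀ t : ℝ, contr (qv b + t • pv a) (contr (qv a + t • pv b) F) =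
      contr (qv b) (contr (qv a) F) + t • (pairContr a F - pairContr b F)
        + t ^ 2 • contr (pv a) (contr (pv b) F) := by
    intro t
    have h := LinearMap.congr_fun (contr_mul_contr (qv b) (pv b)) F
    simp only [Module.End.mul_apply, LinearMap.neg_apply] at h
    rw [hl.contr_add_smul, map_add, map_smul, (hl.contr _).contr_add_smul,
      (hl.contr _).contr_add_smul, h]
    simp only [pairContr, Module.End.mul_apply]
    module
  have h1 := hF.contr_pair ha hb hab 1 S hS hR I hI hIR
  have h2 := hF.contr_pair ha hb hab (-1) S hS hR I hI hIR
  rw [key] at h1 h2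
  simp only [AltFun.add_apply, AltFun.smul_apply] at h1 h2
  linarith

theorem contr_mul_pairContr (w : Vec (2 * n + 1)) (a : Fin n) :
    contr w * pairContr a = pairContr a * contr w := by
  rw [pairContr, ← mul_assoc, contr_mul_contr w, neg_mul, mul_assoc, contr_mul_contr w, mul_neg,
    neg_neg, mul_assoc]

theorem pairContr_comm (a b : Fin n) :
    pairContr a * pairContr b = pairContr b * pairContr a := by
  rw [pairContr, mul_assoc, contr_mul_pairContr, ← mul_assoc, contr_mul_pairContr, mul_assoc]

theorem pairContr_mul_contr_bas (a : Fin n) (s : Bool) :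
    pairContr a * contr (bas (a, s)) = 0 := by
  have h : ∀ w : Vec (2 * n + 1), contr w * contr w = 0 := fun w =>
    LinearMap.ext fun F => contr_contr_self w F
  cases s
  · simp [bas, pairContr, mul_assoc, h]
  · rw [← contr_mul_pairContr]
    simp [bas, pairContr, ← mul_assoc, h]

theorem pairContr_mul_self (a : Fin n) : pairContr a * pairContr a = 0 := by
  have h := pairContr_mul_contr_bas a true
  simp only [bas, if_true] at h
  nth_rw 2 [pairContr]
  rw [← mul_assoc, h, zero_mul]

theorem pairContr_apply_eq_zero {F : AltFun (Vec (2 * n + 1))} {b : Fin n}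
    {l : List (Fin n × Bool)} (hb : b ∈ l.map Prod.fst) : pairContr b F (l.map bas) = 0 := by
  obtain ⟨⟨b, s⟩, hx, rfl⟩ := List.mem_map.mp hb
  refine apply_eq_zero_of_perm ((List.perm_cons_erase hx).map bas) ?_
  rw [List.map_cons, ← contr_apply]
  have h := LinearMap.congr_fun (pairContr_mul_contr_bas b s) F
  rw [← contr_mul_pairContr] at h
  exact congrArg (fun G : AltFun (Vec (2 * n + 1)) => G ((l.erase (b, s)).map bas)) h

theorem apply_bas_cons_cons (F : AltFun (Vec (2 * n + 1))) (a : Fin n) (s t : Bool)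
    (l : List (Fin n × Bool)) (h : pairContr a F (l.map bas) = 0) :
    F (((a, s) :: (a, t) :: l).map bas) = 0 := by
  have hself : ∀ x : Fin n × Bool, F ((x :: x :: l).map bas) = 0 := fun x =>
    congrArg (fun G : AltFun (Vec (2 * n + 1)) => G (l.map bas)) (contr_contr_self (bas x) F)
  have hqp : F (((a, false) :: (a, true) :: l).map bas) = 0 := h
  cases s <;> cases t
  · exact hself _
  · exact hqp
  · exact apply_eq_zero_of_perm ((List.Perm.swap _ _ _).map bas) hqp
  · exact hself _

theorem VanishOn.apply_bas_eq_zero {R : Finset (Fin n)} {F : AltFun (Vec (2 * n + 1))}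
    (hF : VanishOn R F) (hl : IsLin F) (hb : (∑ b ∈ R, pairContr b) F = 0)
    {l : List (Fin n × Bool)} (hlen : l.length = R.card) (hlR : ∀ x ∈ l, x.1 ∈ R) :
    F (l.map bas) = 0 := by
  induction R using Finset.strongInduction generalizing F l with
  | H R ih =>
  cases l with
  | nil =>
    have hR : R = ∅ := by simpa using hlen.symm
    exact hF 0 (fun _ _ => rfl) (fun _ _ _ => rfl) [] List.nodup_nil (by simp [hR])
  | cons c l =>
  obtain ⟨a, s⟩ := c
  have haR : a ∈ R := hlR (a, s) (by simp)
  by_cases hal : a ∈ l.map Prod.fst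
  · obtain ⟨⟨a, t⟩, hx, rfl⟩ := List.mem_map.mp hal
    obtain ⟨l', hp⟩ : ∃ l', l.Perm ((a, t) :: l') := ⟨_, List.perm_cons_erase hx⟩
    refine apply_eq_zero_of_perm ((hp.cons (a, s)).map bas) ?_
    apply apply_bas_cons_cons
    have hlen' : l'.length + 2 = R.card := by
      have := hp.length_eq
      simp only [List.length_cons] at hlen this
      omega
    have hlR' : ∀ x ∈ l', x.1 ∈ R := fun x hx => hlR x (by simp [hp.mem_iff, hx])
    by_cases hal' : a ∈ l'.map Prod.fst
    · exact pairContr_apply_eq_zero hal'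
    have key : ∀ b ∈ R, pairContr b F (l'.map bas) =
        if b ∈ l'.map Prod.fst then 0 else pairContr a F (l'.map bas) := by
      intro b hbR
      split_ifs with hbl
      · exact pairContr_apply_eq_zero hbl
      by_cases hab : a = b
      · rw [hab]
      have hbR' : b ∈ R.erase a := by simp [hbR, Ne.symm hab]
      have h := ih ((R.erase a).erase b)
        ((Finset.erase_subset _ _).trans_ssubset (Finset.erase_ssubset haR))
        (hF.pairContr_sub hl haR hbR hab)
        (((hl.contr _).contr _).sub ((hl.contr _).contr _)) ?_ (l := l')
        (by rw [Finset.card_erase_of_mem hbR', Finset.card_erase_of_mem haR]; omega)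
        (fun x hx => by
          have h1 : x.1 ≠ b := fun h => hbl (List.mem_map.mpr ⟨x, hx, h⟩)
          have h2 : x.1 ≠ a := fun h => hal' (List.mem_map.mpr ⟨x, hx, h⟩)
          simp [h1, h2, hlR' x hx])
      · simp only [AltFun.sub_apply] at h
        linarith
      · have hsum : ∑ c ∈ (R.erase a).erase b, pairContr c
            = ∑ c ∈ R, pairContr c - pairContr a - pairContr b := by
          rw [← Finset.add_sum_erase R _ haR, ← Finset.add_sum_erase _ _ hbR']
          abel
        have hz : (∑ c ∈ R, pairContr c - pairContr a - pairContr b)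
            * (pairContr a - pairContr b)
            = (pairContr a - pairContr b) * ∑ c ∈ R, pairContr c := by
          have hcomm : ∀ d, (∑ c ∈ R, pairContr c) * pairContr d
              = pairContr d * ∑ c ∈ R, pairContr c := fun d => by
            rw [Finset.sum_mul, Finset.mul_sum]
            exact Finset.sum_congr rfl fun c _ => pairContr_comm c d
          simp only [sub_mul, mul_sub, pairContr_mul_self, pairContr_comm b a, hcomm]
          abel
        have := LinearMap.congr_fun hz F
        rw [Module.End.mul_apply, Module.End.mul_apply, hb, map_zero] at this
        rw [hsum]
        exact this
    have h0 : ∑ b ∈ R, pairContr b F (l'.map bas) = 0 := by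
      have := congrArg (fun G : AltFun (Vec (2 * n + 1)) => G (l'.map bas)) hb
      simpa using this
    rw [Finset.sum_congr rfl key, Finset.sum_ite, Finset.sum_const_zero, zero_add,
      Finset.sum_const, nsmul_eq_mul] at h0
    refine (mul_eq_zero.mp h0).resolve_left ?_
    have : 0 < (R.filter fun b => b ∉ l'.map Prod.fst).card :=
      Finset.card_pos.mpr ⟨a, by simp only [Finset.mem_filter]; exact ⟨haR, hal'⟩⟩
    exact_mod_cast this.ne'
  · refine ih (R.erase a) (Finset.erase_ssubset haR) (hF.contr_bas hl haR s) (hl.contr _) ?_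
      (by rw [Finset.card_erase_of_mem haR, ← hlen]; simp)
      (fun x hx => by
        have h1 : x.1 ≠ a := fun h => hal (List.mem_map.mpr ⟨x, hx, h⟩)
        simp [h1, hlR x (by simp [hx])])
    have hz : (∑ b ∈ R.erase a, pairContr b) * contr (bas (a, s))
        = contr (bas (a, s)) * ∑ b ∈ R, pairContr b := by
      rw [← Finset.add_sum_erase R _ haR, mul_add, contr_mul_pairContr,
        pairContr_mul_contr_bas, zero_add, Finset.sum_mul, Finset.mul_sum]
      simp only [contr_mul_pairContr]
    have := LinearMap.congr_fun hz F
    rw [Module.End.mul_apply, Module.End.mul_apply, hb, map_zero] at this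
    exact this

/-- An effective form of degree `n` vanishing on all Lagrangian graphs is zero. -/
theorem IsLin.eq_zero_of_graph {F : AltFun (Vec (2 * n + 1))} (hl : IsLin F) (hd : HasDeg n F)
    (hb : MA.bot n F = 0) (hF : VanishOn Finset.univ F) : F = 0 := by
  refine hl.eq_zero fun l => ?_
  by_cases hlen : l.length = n
  · exact hF.apply_bas_eq_zero hl hb (by simpa using hlen) (by simp)
  · exact hd _ (by simpa using hlen)

end Symplectic

/-- The signed sum of a function on `k`-tuples of vectors over all permutations of its arguments. -/
def alternation {W : Type*} {k : ℕ} (g : (Fin k → W) → ℝ) (v : Fin k → W) : ℝ :=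
  ∑ σ : Equiv.Perm (Fin k), ((Equiv.Perm.sign σ : ℤ) : ℝ) * g (v ∘ σ)

theorem alternation_comp_perm {W : Type*} {k : ℕ} (g : (Fin k → W) → ℝ) (v : Fin k → W)
    (τ : Equiv.Perm (Fin k)) :
    alternation g (v ∘ τ) = ((Equiv.Perm.sign τ : ℤ) : ℝ) * alternation g v := by
  rw [alternation, alternation, Finset.mul_sum]
  refine Fintype.sum_equiv (Equiv.mulLeft τ) _ _ fun σ => ?_
  rcases Int.units_eq_one_or (Equiv.Perm.sign τ) with h | h <;>
    simp [h, Function.comp_assoc]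

theorem alternation_perm_comp {W : Type*} {k : ℕ} (g : (Fin k → W) → ℝ) (v : Fin k → W)
    (τ : Equiv.Perm (Fin k)) :
    alternation (fun u => g (u ∘ τ)) v = ((Equiv.Perm.sign τ : ℤ) : ℝ) * alternation g v := by
  rw [alternation, alternation, Finset.mul_sum]
  refine Fintype.sum_equiv (Equiv.mulRight τ) _ _ fun σ => ?_
  rcases Int.units_eq_one_or (Equiv.Perm.sign τ) with h | h <;>
    simp [h, Function.comp_assoc]

theorem alternation_sum {W ι : Type*} {k : ℕ} (s : Finset ι) (g : ι → (Fin k → W) → ℝ)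
    (v : Fin k → W) :
    alternation (fun u => ∑ i ∈ s, g i u) v = ∑ i ∈ s, alternation (g i) v := by
  simp only [alternation, Finset.mul_sum]
  exact Finset.sum_comm

theorem alternation_sub {W : Type*} {k : ℕ} (g h : (Fin k → W) → ℝ) (v : Fin k → W) :
    alternation (fun u => g u - h u) v = alternation g v - alternation h v := by
  simp only [alternation, mul_sub, Finset.sum_sub_distrib]

theorem alternation_cons {W : Type*} {k : ℕ} (f : W → ℝ) (g : (Fin k → W) → ℝ)
    (v : Fin (k + 1) → W) :
    alternation (fun u => f (u 0) * g (u ∘ Fin.succ)) v =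
      ∑ j : Fin (k + 1), (-1 : ℝ) ^ (j : ℕ) * f (v j) * alternation g (v ∘ j.succAbove) := by
  rw [alternation, Finset.univ_perm_fin_succ, ← Finset.univ_product_univ]
  simp only [Finset.sum_map, Equiv.toEmbedding_apply, Finset.sum_product]
  refine Finset.sum_congr rfl fun j _ => ?_
  rw [alternation, Finset.mul_sum]
  refine Fin.cases ?_ (fun i => ?_) j
  · refine Finset.sum_congr rfl fun σ _ => ?_
    have h : (v ∘ Equiv.Perm.decomposeFin.symm (0, σ)) ∘ Fin.succ = (v ∘ Fin.succAbove 0) ∘ σ := by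
      funext x
      simp
    rw [h]
    simp
    ring
  · refine Fintype.sum_equiv (Equiv.mulLeft i.cycleRange) _ _ fun σ => ?_
    have h : (v ∘ Equiv.Perm.decomposeFin.symm (i.succ, σ)) ∘ Fin.succ
        = (v ∘ i.succ.succAbove) ∘ (i.cycleRange * σ) := by
      funext x
      simp [Fin.succAbove_cycleRange]
    have h2 : ((-1 : ℝ) ^ (i : ℕ)) * (-1) ^ (i : ℕ) = 1 := by
      rw [← mul_pow]; simp
    rw [h]
    simp [Equiv.Perm.decomposeFin.symm_sign, Fin.sign_cycleRange, pow_succ]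
    linear_combination -((Equiv.Perm.sign σ : ℤ) : ℝ) * f (v i.succ) *
      g ((v ∘ i.succ.succAbove) ∘ i.cycleRange ∘ σ) * h2

/-- The alternation of a function on `k`-tuples of vectors, as a function on lists. -/
def alt {W : Type*} {k : ℕ} (g : (Fin k → W) → ℝ) : AltFun W where
  val l := if h : l.length = k then alternation g fun i => l.get (i.cast h.symm) else 0
  property l a b l' := by
    by_cases h : (l ++ a :: b :: l').length = k
    · have h' : (l ++ b :: a :: l').length = k := by simpa using h
      beta_reduce
      rw [dif_pos h, dif_pos h']
      subst h
      have hi : l.length < (l ++ a :: b :: l').length := by simp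
      have hj : l.length + 1 < (l ++ a :: b :: l').length := by simp
      have hne : (⟨_, hi⟩ : Fin (l ++ a :: b :: l').length) ≠ ⟨_, hj⟩ := by simp
      have := alternation_comp_perm g (fun i => (l ++ b :: a :: l').get (i.cast h'.symm))
        (Equiv.swap ⟨_, hi⟩ ⟨_, hj⟩)
      rw [Equiv.Perm.sign_swap hne] at this
      have h2 : (fun i => (l ++ b :: a :: l').get (i.cast h'.symm)) ∘
          (Equiv.swap ⟨_, hi⟩ ⟨_, hj⟩ : Equiv.Perm (Fin (l ++ a :: b :: l').length))
          = fun i => (l ++ a :: b :: l').get (i.cast rfl) := by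
        funext i
        rw [Function.comp_apply, Equiv.swap_apply_def]
        split_ifs with h3 h4
        · subst h3; simp
        · subst h4; simp
        · have h3' : (i : ℕ) ≠ l.length := fun e => h3 (Fin.ext e)
          have h4' : (i : ℕ) ≠ l.length + 1 := fun e => h4 (Fin.ext e)
          simp only [List.get_eq_getElem, Fin.val_cast, List.getElem_append, List.getElem_cons]
          split_ifs <;> first | rfl | omega
      rw [← h2, this]
      simp
    · have h' : (l ++ b :: a :: l').length ≠ k := by simpa using h
      beta_reduce
      rw [dif_neg h, dif_neg h', neg_zero]

theorem alt_apply_ofFn {W : Type*} {k : ℕ} (g : (Fin k → W) → ℝ) (v : Fin k → W) :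
    alt g (List.ofFn v) = alternation g v := by
  simp [alt]

theorem hasDeg_alt {W : Type*} {k : ℕ} (g : (Fin k → W) → ℝ) : HasDeg k (alt g) :=
  fun _ hl => dif_neg hl

theorem ext_apply_ofFn {W : Type*} {k : ℕ} (f : W → ℝ) (F : AltFun W) (v : Fin (k + 1) → W) :
    ext f F (List.ofFn v) =
      ∑ j : Fin (k + 1), (-1 : ℝ) ^ (j : ℕ) * f (v j) * F (List.ofFn (v ∘ j.succAbove)) := by
  induction k generalizing F with
  | zero => simp [ext_apply_cons, ext_apply_nil]
  | succ k ih =>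
    rw [List.ofFn_succ, ext_apply_cons, Fin.sum_univ_succ, ih]
    simp only [contr_apply, sub_eq_add_neg, ← Finset.sum_neg_distrib]
    congr 1
    · simp [Function.comp_def]
    · refine Finset.sum_congr rfl fun j _ => ?_
      have h : List.ofFn (v ∘ j.succ.succAbove)
          = v 0 :: List.ofFn ((fun i => v i.succ) ∘ j.succAbove) := by
        rw [List.ofFn_succ]
        simp [Function.comp_def]
      rw [h, Fin.val_succ, pow_succ]
      ring

theorem AltFun.ext_ofFn {W : Type*} {k : ℕ} {F G : AltFun W} (hF : HasDeg k F) (hG : HasDeg k G)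
    (h : ∀ v : Fin k → W, F (List.ofFn v) = G (List.ofFn v)) : F = G := by
  ext l
  by_cases hl : l.length = k
  · subst hl
    simpa using h l.get
  · rw [hF l hl, hG l hl]

theorem alt_cons {W : Type*} {k : ℕ} (f : W → ℝ) (g : (Fin k → W) → ℝ) :
    alt (fun u : Fin (k + 1) → W => f (u 0) * g (u ∘ Fin.succ)) = ext f (alt g) := by
  refine AltFun.ext_ofFn (hasDeg_alt _) ((hasDeg_alt g).ext f) fun v => ?_
  simp only [alt_apply_ofFn, alternation_cons, ext_apply_ofFn]

theorem symp_apply {n : ℕ} (X : Vec (2 * n + 1)) (w : Fin 2 → Vec (2 * n + 1)) :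
    symp X w = ∑ μ : Fin n, (qc μ (w 0) * pc μ (w 1) - pc μ (w 0) * qc μ (w 1)) := by
  have h : (Finset.univ : Finset (Equiv.Perm (Fin (1 + 1)))) = {1, Equiv.swap 0 1} := by decide
  simp only [symp, Finset.sum_apply]
  refine Finset.sum_congr rfl fun μ _ => ?_
  have hne : (1 : Equiv.Perm (Fin (1 + 1))) ≠ Equiv.swap 0 1 := by decide
  simp only [wedge, h, dx]
  rw [Finset.sum_pair hne]
  simp [qc, pc]
  ring

/-- Wedging with `Ω` is, up to a constant, the Lefschetz operator. -/
theorem exists_wedge_symp (n k : ℕ) : ∃ c : ℝ, ∀ (x : Form (2 * n + 1) k) (X : Vec (2 * n + 1))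
    (v : Fin (k + 2) → Vec (2 * n + 1)),
    wedge x symp X v = c * lef n (alt (x X)) (List.ofFn v) := by
  let ρ : Equiv.Perm (Fin (k + 2)) := (finCongr (Nat.add_comm k 2)).trans finAddFlip
  have h0 : ρ 0 = Fin.natAdd k 0 := finAddFlip_apply_castAdd (0 : Fin 2) k
  have h1 : ρ 1 = Fin.natAdd k 1 := finAddFlip_apply_castAdd (1 : Fin 2) k
  have h2 : ∀ i, ρ (Fin.succ (Fin.succ i)) = Fin.castAdd 2 i := fun i => by
    have h : Fin.cast (Nat.add_comm k 2) i.succ.succ = Fin.natAdd 2 i := by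
      ext
      simp
      omega
    change finAddFlip (Fin.cast (Nat.add_comm k 2) i.succ.succ) = _
    rw [h, finAddFlip_apply_natAdd]
  refine ⟨((k.factorial * Nat.factorial 2 : ℕ) : ℝ)⁻¹ * ((Equiv.Perm.sign ρ : ℤ) : ℝ) * 2,
    fun x X v => ?_⟩
  let H (f g : Vec (2 * n + 1) → ℝ) (u : Fin (k + 2) → Vec (2 * n + 1)) : ℝ :=
    f (u 0) * (g ((u ∘ Fin.succ) 0) * x X ((u ∘ Fin.succ) ∘ Fin.succ))
  have hH : ∀ f g, alternation (H f g) v = ext f (ext g (alt (x X))) (List.ofFn v) := by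
    intro f g
    rw [← alt_cons g, ← alt_cons f, alt_apply_ofFn]
  have hw : wedge x symp X v = ((k.factorial * Nat.factorial 2 : ℕ) : ℝ)⁻¹ * alternation
      (fun u => ∑ μ : Fin n, (H (qc μ) (pc μ) (u ∘ ρ) - H (pc μ) (qc μ) (u ∘ ρ))) v := by
    rw [wedge, alternation]
    congr 1
    refine Finset.sum_congr rfl fun σ _ => ?_
    rw [symp_apply, mul_assoc, Finset.mul_sum]
    congr 1
    refine Finset.sum_congr rfl fun μ _ => ?_
    have h3 : (((v ∘ σ) ∘ ρ) ∘ Fin.succ) ∘ Fin.succ = fun i => v (σ (Fin.castAdd 2 i)) := by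
      funext i
      simp [h2]
    simp only [H, h3, Function.comp_apply, h0, h1, Fin.succ_zero_eq_one]
    ring
  rw [hw, alternation_perm_comp fun u => ∑ μ : Fin n, (H (qc μ) (pc μ) u - H (pc μ) (qc μ) u),
    alternation_sum]
  have h4 : ∀ μ : Fin n, alternation (fun u => H (qc μ) (pc μ) u - H (pc μ) (qc μ) u) v
      = 2 * ext (qc μ) (ext (pc μ) (alt (x X))) (List.ofFn v) := by
    intro μ
    have h5 := congrArg (fun G : AltFun (Vec (2 * n + 1)) => G (List.ofFn v))
      (LinearMap.congr_fun (ext_mul_ext (pc μ) (qc μ)) (alt (x X)))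
    simp only [Module.End.mul_apply, LinearMap.neg_apply, AltFun.neg_apply] at h5
    rw [alternation_sub, hH, hH, h5]
    ring
  simp only [h4, lef, LinearMap.sum_apply, AltFun.sum_apply, Module.End.mul_apply,
    ← Finset.mul_sum]
  ring

/-- An alternating map as a function on lists. -/
def ofAlternating {W : Type*} [AddCommGroup W] [Module ℝ W] {k : ℕ} (a : W [⋀^Fin k]→ₗ[ℝ] ℝ) :
    AltFun W := ((k.factorial : ℝ)⁻¹) • alt a

theorem ofAlternating_apply_ofFn {W : Type*} [AddCommGroup W] [Module ℝ W] {k : ℕ}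
    (a : W [⋀^Fin k]→ₗ[ℝ] ℝ) (v : Fin k → W) : ofAlternating a (List.ofFn v) = a v := by
  have h : alternation a v = k.factorial * a v := by
    have : ∀ σ : Equiv.Perm (Fin k), ((Equiv.Perm.sign σ : ℤ) : ℝ) * a (v ∘ σ) = a v := by
      intro σ
      rw [a.map_perm]
      rcases Int.units_eq_one_or (Equiv.Perm.sign σ) with h | h <;> simp [h]
    simp [alternation, this, Fintype.card_perm]
  have hk : (k.factorial : ℝ) ≠ 0 := by exact_mod_cast k.factorial_ne_zero
  rw [ofAlternating, AltFun.smul_apply, alt_apply_ofFn, h]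
  field_simp

theorem hasDeg_ofAlternating {W : Type*} [AddCommGroup W] [Module ℝ W] {k : ℕ}
    (a : W [⋀^Fin k]→ₗ[ℝ] ℝ) : HasDeg k (ofAlternating a) := (hasDeg_alt _).smul _

theorem idx_cases {n : ℕ} (i : Fin (2 * n + 1)) :
    (∃ μ : Fin n, i = qIdx μ) ∨ i = uIdx ∨ ∃ μ : Fin n, i = pIdx μ := by
  rcases lt_trichotomy (i : ℕ) n with h | h | h
  · exact Or.inl ⟨⟨i, h⟩, rfl⟩
  · exact Or.inr (Or.inl (Fin.ext h))
  · exact Or.inr (Or.inr ⟨⟨i - (n + 1), by have := i.isLt; omega⟩,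
      Fin.ext (by simp [pIdx]; omega)⟩)

theorem vec_eq_sum {n : ℕ} (w : Vec (2 * n + 1)) :
    w = ∑ μ : Fin n, (qc μ w • qv μ + pc μ w • pv μ) + w uIdx • chi := by
  have hq : ∀ μ : Fin n, (chi : Vec (2 * n + 1)) (qIdx μ) = 0 := fun μ => by
    have := μ.isLt
    simp [chi, basisVec, qIdx, uIdx, Pi.single_apply, Fin.ext_iff]
    omega
  have hp : ∀ μ : Fin n, (chi : Vec (2 * n + 1)) (pIdx μ) = 0 := fun μ => by
    simp [chi, basisVec, pIdx, uIdx, Pi.single_apply, Fin.ext_iff]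
    omega
  have huq : ∀ μ : Fin n, (qv μ : Vec (2 * n + 1)) uIdx = 0 := fun μ => by
    have := μ.isLt
    simp [qv, basisVec, qIdx, uIdx, Pi.single_apply, Fin.ext_iff]
    omega
  have hup : ∀ μ : Fin n, (pv μ : Vec (2 * n + 1)) uIdx = 0 := fun μ => by
    simp [pv, basisVec, pIdx, uIdx, Pi.single_apply, Fin.ext_iff]
    omega
  funext i
  rcases idx_cases i with ⟨μ, rfl⟩ | rfl | ⟨μ, rfl⟩
  · change qc μ w = qc μ (_ + w uIdx • chi)
    rw [qc_add, qc_smul, show qc μ chi = 0 from hq μ]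
    simp
  · simp [huq, hup, chi, basisVec]
  · change pc μ w = pc μ (_ + w uIdx • chi)
    rw [pc_add, pc_smul, show pc μ chi = 0 from hp μ]
    simp

theorem isLin_ofAlternating {n k : ℕ} (a : Vec (2 * n + 1) [⋀^Fin (k + 1)]→ₗ[ℝ] ℝ)
    (ha : ∀ u, a (Fin.cons chi u) = 0) : IsLin (ofAlternating a) := by
  have hc : ∀ w u, contr w (ofAlternating a) (List.ofFn u) = a.curryLeft w u := fun w u => by
    have h := ofAlternating_apply_ofFn a (Fin.cons w u)
    rw [List.ofFn_succ] at h
    exact h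
  intro w
  have hd := fun v => (hasDeg_ofAlternating a).contr v
  refine AltFun.ext_ofFn (hd w) (fun l hl => by simp [linContr, hd _ l hl]) fun u => ?_
  have hchi : a.curryLeft chi u = 0 := ha u
  rw [hc]
  have hs : ∀ f : Fin n → Vec (2 * n + 1) [⋀^Fin k]→ₗ[ℝ] ℝ, (∑ μ, f μ) u = ∑ μ, f μ u :=
    fun f => map_sum (⟨⟨fun g => g u, rfl⟩, fun _ _ => rfl⟩ :
      Vec (2 * n + 1) [⋀^Fin k]→ₗ[ℝ] ℝ →+ ℝ) f _
  conv_lhs => rw [vec_eq_sum w]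
  simp only [linContr, hc, hchi, map_add, map_sum, map_smul, LinearMap.sum_apply,
    LinearMap.add_apply, LinearMap.smul_apply, AltFun.sum_apply, AltFun.add_apply,
    AltFun.smul_apply, AlternatingMap.add_apply, AlternatingMap.smul_apply, hs, smul_eq_mul,
    mul_zero, add_zero]

theorem exists_jet {n : ℕ} (X : Vec (2 * n + 1)) (S : Fin n → Fin n → ℝ)
    (hS : ∀ i j, S i j = S j i) :
    ∃ φ : Vec n → ℝ, ContDiff ℝ (⊤ : ℕ∞) φ ∧ ∃ y : Vec n, jet φ y = X ∧ ∀ i μ,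
      qc μ (fderiv ℝ (jet φ) y (basisVec i)) = (if μ = i then 1 else 0) ∧
      pc μ (fderiv ℝ (jet φ) y (basisVec i)) = S μ i := by
  let y₀ : Vec n := fun i => X (qIdx i)
  let φ : Vec n → ℝ := fun y => X uIdx +
    ∑ i, (y i - y₀ i) * (X (pIdx i) + 2⁻¹ * ∑ j, S i j * (y j - y₀ j))
  have hφ : ContDiff ℝ (⊤ : ℕ∞) φ := by fun_prop
  have hd : ∀ (i : Fin n) (y : Vec n), HasFDerivAt (fun y : Vec n => y i - y₀ i)
      (ContinuousLinearMap.proj i : Vec n →L[ℝ] ℝ) y := fun i y =>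
    (hasFDerivAt_apply i y).sub_const _
  have hderiv : ∀ y b, fderiv ℝ φ y (basisVec b)
      = X (pIdx b) + ∑ j, S b j * (y j - y₀ j) := by
    intro y b
    have h : HasFDerivAt φ _ y :=
      (HasFDerivAt.fun_sum (u := Finset.univ) fun i _ => (hd i y).fun_mul
      (((HasFDerivAt.fun_sum (u := Finset.univ) fun j _ =>
        (hd j y).const_mul (S i j)).const_mul 2⁻¹).const_add (X (pIdx i)))).const_add (X uIdx)
    rw [h.fderiv]
    simp only [basisVec, sum_apply, add_apply, smul_apply,
      ContinuousLinearMap.proj_apply, Pi.single_apply, smul_eq_mul, mul_ite, mul_one, mul_zero,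
      Finset.sum_add_distrib, Finset.sum_ite_eq', Finset.mem_univ, if_true, hS b]
    rw [add_left_comm, Finset.mul_sum, ← Finset.sum_add_distrib]
    congr 1
    exact Finset.sum_congr rfl fun j _ => by ring
  have hjq : ∀ y b, jet φ y (qIdx b) = y b := fun y b => by
    simp [jet, qIdx]
  have hju : ∀ y, jet φ y uIdx = φ y := fun y => by
    simp [jet, uIdx]
  have hjp : ∀ y b, jet φ y (pIdx b) = X (pIdx b) + ∑ j, S b j * (y j - y₀ j) := fun y b => by
    rw [← hderiv]
    have h1 : ¬(n + 1 + (b : ℕ) < n) := by omega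
    have h2 : ¬(n + 1 + (b : ℕ) = n) := by omega
    simp [jet, pIdx, h1, h2]
  have hjet : DifferentiableAt ℝ (jet φ) y₀ := by
    refine differentiableAt_pi.2 fun i => ?_
    rcases idx_cases i with ⟨μ, rfl⟩ | rfl | ⟨μ, rfl⟩
    · simp only [hjq]
      fun_prop
    · simp only [hju]
      exact (hφ.differentiable (by simp)).differentiableAt
    · simp only [hjp]
      fun_prop
  have hcomp : ∀ b i, fderiv ℝ (jet φ) y₀ (basisVec i) b
      = fderiv ℝ (fun y => jet φ y b) y₀ (basisVec i) := fun b i => by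
    rw [fderiv_apply hjet]
    rfl
  refine ⟨φ, hφ, y₀, ?_, fun i μ => ⟨?_, ?_⟩⟩
  · funext i
    rcases idx_cases i with ⟨μ, rfl⟩ | rfl | ⟨μ, rfl⟩
    · rw [hjq]
    · rw [hju]
      simp [φ]
    · rw [hjp]
      simp
  · rw [qc, hcomp]
    simp only [hjq]
    rw [(hasFDerivAt_apply μ y₀).fderiv]
    simp [basisVec, Pi.single_apply]
  · rw [pc, hcomp]
    simp only [hjp]
    rw [((HasFDerivAt.fun_sum (u := Finset.univ) fun j _ =>
      (hd j y₀).const_mul (S μ j)).const_add _).fderiv]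
    simp [basisVec, Pi.single_apply]

/-- A multilinear form killed by `χ` which vanishes on all first prolongations vanishes on
Lagrangian graphs. -/
theorem apply_graphVec_eq_zero {n : ℕ} {ω : Form (2 * n + 1) n}
    (hω : ∀ φ : Vec n → ℝ, ContDiff ℝ (⊤ : ℕ∞) φ → pullback (jet φ) ω = 0)
    {X : Vec (2 * n + 1)} {F : AltFun (Vec (2 * n + 1))} (hl : IsLin F)
    (hF : ∀ v, F (List.ofFn v) = ω X v) {S : Fin n → Fin n → ℝ} (hS : ∀ i j, S i j = S j i)
    (I : List (Fin n)) (hI : I.length = n) : F (I.map (graphVec S)) = 0 := by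
  obtain ⟨φ, hφ, y, hy, hd⟩ := exists_jet X S hS
  rw [hl.apply_congr I (graphVec S) (fun i => fderiv ℝ (jet φ) y (basisVec i))
    (fun i μ => by simp [(hd i μ).1, graphVec]) (fun i μ => by simp [(hd i μ).2, graphVec, hS μ i])]
  have h := congrFun (congrFun (hω φ hφ) y) fun i : Fin n => basisVec (I.get (i.cast hI.symm))
  rw [pullback, hy, ← hF] at h
  refine Eq.trans (congrArg (fun l => F l) ?_) h
  apply List.ext_get <;> simp [hI]

/-- if two n-forms `ω₁, ω₂` on ℝ^{2n+1} with `χ ⌟ ωᵢ = 0` determine the same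
Monge–Ampère equation, i.e. `(j¹φ)*(ω₁ − k·ω₂) = 0` for all smooth `φ` and a
nowhere-vanishing smooth `k`, then their effective parts satisfy `ω₁ε = k·ω₂ε`. -/
theorem effective_parts_proportional (n : ℕ) (hn : 2 ≤ n)
    (ω₁ ω₂ : Form (2 * n + 1) n)
    (h₁ : IsForm ω₁) (hs₁ : SmoothForm ω₁) (h₂ : IsForm ω₂) (hs₂ : SmoothForm ω₂)
    (hχ₁ : iprod (chi (n := n)) ω₁ = 0) (hχ₂ : iprod (chi (n := n)) ω₂ = 0)
    (k : Vec (2 * n + 1) → ℝ) (hk : ContDiff ℝ (⊤ : ℕ∞) k) (hk0 : ∀ x, k x ≠ 0)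
    (hsame : ∀ φ : Vec n → ℝ, ContDiff ℝ (⊤ : ℕ∞) φ →
      pullback (jet φ) (ω₁ - fsmul k ω₂) = 0) :
    ∀ (ωε₁ ωε₂ : Form (2 * n + 1) n) (x₁ x₂ : Form (2 * n + 1) (n - 2)),
      iprod (chi (n := n)) ωε₁ = 0 → botOp ωε₁ = 0 → iprod (chi (n := n)) x₁ = 0 →
      ω₁ = ωε₁ + reindex (show n - 2 + 2 = n by omega) (wedge x₁ (symp (n := n))) →
      iprod (chi (n := n)) ωε₂ = 0 → botOp ωε₂ = 0 → iprod (chi (n := n)) x₂ = 0 →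
      ω₂ = ωε₂ + reindex (show n - 2 + 2 = n by omega) (wedge x₂ (symp (n := n))) →
      ωε₁ = fsmul k ωε₂ := by
  obtain ⟨m, rfl⟩ : ∃ m, n = m + 2 := ⟨n - 2, by omega⟩
  intro ωε₁ ωε₂ x₁ x₂ _ hb₁ _ he₁ _ hb₂ _ he₂
  obtain ⟨c, hc⟩ := exists_wedge_symp (m + 2) m
  funext X v
  obtain ⟨a₁, ha₁⟩ := h₁ X
  obtain ⟨a₂, ha₂⟩ := h₂ X
  let a := a₁ - k X • a₂
  have ha : ∀ v, ofAlternating a (List.ofFn v) = (ω₁ - fsmul k ω₂) X v := fun v => by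
    rw [ofAlternating_apply_ofFn]
    simp [a, fsmul, ha₁, ha₂]
  have haχ : ∀ u, a (Fin.cons chi u) = 0 := fun u => by
    have e₁ : ω₁ X (Fin.cons chi u) = 0 := congrFun (congrFun hχ₁ X) u
    have e₂ : ω₂ X (Fin.cons chi u) = 0 := congrFun (congrFun hχ₂ X) u
    rw [ha₁] at e₁
    rw [ha₂] at e₂
    simp only [a, AlternatingMap.sub_apply, AlternatingMap.smul_apply, e₁, e₂, smul_zero, sub_zero]
  have hal := isLin_ofAlternating a haχ
  have had := hasDeg_ofAlternating a
  obtain ⟨F, hF⟩ : ∃ F, F = c • (alt (x₁ X) - k X • alt (x₂ X)) := ⟨_, rfl⟩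
  have hFd : HasDeg m F := by
    rw [hF]
    exact ((hasDeg_alt _).sub ((hasDeg_alt _).smul _)).smul _
  have hGd : HasDeg (m + 2) (ofAlternating a - lef (m + 2) F) := had.sub hFd.lef
  have hG : ∀ v, (ofAlternating a - lef (m + 2) F) (List.ofFn v)
      = ωε₁ X v - k X * ωε₂ X v := fun v => by
    have e₁ : ω₁ X v = ωε₁ X v + wedge x₁ symp X v := congrFun (congrFun he₁ X) v
    have e₂ : ω₂ X v = ωε₂ X v + wedge x₂ symp X v := congrFun (congrFun he₂ X) v
    rw [hc] at e₁ e₂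
    simp only [AltFun.sub_apply, ha, hF, map_smul, map_sub, AltFun.smul_apply, Pi.sub_apply, fsmul,
      e₁, e₂]
    ring
  have hbot : bot (m + 2) (ofAlternating a - lef (m + 2) F) = 0 := by
    refine AltFun.ext_ofFn hGd.bot (fun _ _ => rfl) fun u => ?_
    have e₁ : botOp ωε₁ X u = 0 := congrFun (congrFun hb₁ X) u
    have e₂ : botOp ωε₂ X u = 0 := congrFun (congrFun hb₂ X) u
    have hbotOp : ∀ ω : Form (2 * (m + 2) + 1) (m + 2), botOp ω X u =
        ∑ μ, ω X (Fin.cons (qv μ) (Fin.cons (pv μ) u : Fin (m + 1) → _)) := fun ω => by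
      rw [botOp, Finset.sum_apply, Finset.sum_apply]
      rfl
    rw [hbotOp] at e₁ e₂
    have e₃ : ∀ μ : Fin (m + 2), (contr (pv μ) * contr (qv μ))
        (ofAlternating a - lef (m + 2) F) (List.ofFn u) =
        ωε₁ X (Fin.cons (qv μ) (Fin.cons (pv μ) u : Fin (m + 1) → _)) -
        k X * ωε₂ X (Fin.cons (qv μ) (Fin.cons (pv μ) u : Fin (m + 1) → _)) := fun μ => by
      rw [← hG, List.ofFn_cons, List.ofFn_cons]
      rfl
    simp only [bot, LinearMap.sum_apply, AltFun.sum_apply, e₃, Finset.sum_sub_distrib,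
      ← Finset.mul_sum, e₁, e₂, mul_zero, sub_zero, AltFun.zero_apply]
  have hlin : IsLin (ofAlternating a - lef (m + 2) F) :=
    isLin_of_bot_eq_zero rfl hal had hFd hGd hbot (sub_add_cancel _ _).symm
  have hzero := hlin.eq_zero_of_graph hGd hbot fun S hS _ I hI hIR => by
    have hlen : I.length = m + 2 := by
      rw [← List.toFinset_card_of_nodup hI,
        Finset.eq_univ_of_forall fun i => List.mem_toFinset.mpr ((hIR i).mpr (Finset.mem_univ i))]
      simp
    rw [AltFun.sub_apply, apply_graphVec_eq_zero hsame hal ha hS I hlen,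
      lef_apply_of_isotropic, sub_zero]
    simp only [List.mem_map]
    rintro _ ⟨i, _, rfl⟩ _ ⟨j, _, rfl⟩
    exact sform_graphVec hS i j
  have h := hG v
  rw [hzero, AltFun.zero_apply] at h
  exact sub_eq_zero.mp h.symm

end MA
end
end
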